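/- Let P be a simple polygon and W a witness set of P; assume Vis(u) equals the closure of its interior for every u ∈ W. Let w ∈ W be a simplicial vertex of GCon(W). Then there exists a vertex w* of the polygon P with w* ∈ Vis(w) such that (W \ {w}) ∪ {w*} is a witness set of P of cardinality |W|. -/

import Mathlib

open Set

noncomputable section

abbrev Plane := EuclideanSpace ℝ (Fin 2)

/-- A simple polygon, given by a cyclic sequence of at least three distinct vertices
whose closed polygonal boundary curve is a Jordan polygon: two edges intersect exactly
when they are consecutive, and then only in their one shared endpoint. -/
structure SimplePolygon where
  n : ℕ
  three_le : 3 ≤ n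
  vertex : ℕ → Plane
  periodic : ∀ i, vertex (i + n) = vertex i
  inj : ∀ i < n, ∀ j < n, vertex i = vertex j → i = j
  jordan : ∀ i < n, ∀ j < n, i ≠ j →
    segment ℝ (vertex i) (vertex (i + 1)) ∩ segment ℝ (vertex j) (vertex (j + 1)) =
      if j = (i + 1) % n then {vertex (i + 1)}
      else if i = (j + 1) % n then {vertex (j + 1)}
      else ∅

namespace SimplePolygon

/-- The boundary curve of the polygon: the union of its edges. -/
def boundary (P : SimplePolygon) : Set Plane :=
  ⋃ i ∈ Finset.range P.n, segment ℝ (P.vertex i) (P.vertex (i + 1))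

/-- The polygon as a region: the boundary together with all bounded connected
components of the complement of the boundary. -/
def region (P : SimplePolygon) : Set Plane :=
  P.boundary ∪ {x | x ∉ P.boundary ∧
    Bornology.IsBounded (connectedComponentIn P.boundaryᶜ x)}

/-- Visibility region of a point `p`: all points `q` of the polygon such that the
closed segment `[p,q]` is contained in the polygon. -/
def Vis (P : SimplePolygon) (p : Plane) : Set Plane :=
  {q | q ∈ P.region ∧ segment ℝ p q ⊆ P.region}

/-- Visibility region of a set. -/
def VisSet (P : SimplePolygon) (S : Set Plane) : Set Plane :=
  ⋃ p ∈ S, P.Vis p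

/-- Two points of the polygon are visible to each other if the segment joining them
lies in the polygon. -/
def Visible (P : SimplePolygon) (p q : Plane) : Prop :=
  p ∈ P.region ∧ q ∈ P.region ∧ segment ℝ p q ⊆ P.region

/-- A witness set: a finite set of points of the polygon with pairwise disjoint
visibility regions. -/
def IsWitnessSet (P : SimplePolygon) (W : Set Plane) : Prop :=
  W.Finite ∧ W ⊆ P.region ∧
    ∀ x ∈ W, ∀ y ∈ W, x ≠ y → P.Vis x ∩ P.Vis y = ∅

/-- The non-visible region of a witness set. -/
def NVis (P : SimplePolygon) (W : Set Plane) : Set Plane :=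
  P.region \ ⋃ w ∈ W, P.Vis w

/-- `Vis p` is regular (has no arms) if it equals the closure of its interior. -/
def VisRegular (P : SimplePolygon) (p : Plane) : Prop :=
  P.Vis p = closure (interior (P.Vis p))

/-- A window of `Vis p`: a non-degenerate closed segment contained in the frontier of
`Vis p` whose intersection with the frontier of the polygon is exactly its two
endpoints, maximal with these properties. -/
def IsWindow (P : SimplePolygon) (p : Plane) (e : Set Plane) : Prop :=
  ∃ a b : Plane, a ≠ b ∧ e = segment ℝ a b ∧
    e ⊆ frontier (P.Vis p) ∧
    e ∩ frontier P.region = {a, b} ∧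
    ∀ a' b' : Plane, a' ≠ b' →
      segment ℝ a' b' ⊆ frontier (P.Vis p) →
      segment ℝ a' b' ∩ frontier P.region = {a', b'} →
      e ⊆ segment ℝ a' b' → e = segment ℝ a' b'

/-- `γ` is (the image of) a neighbor witness path between `w` and `w'`. -/
def IsNWPath (P : SimplePolygon) (W : Set Plane) (w w' : Plane) (γ : Set Plane) : Prop :=
  ∃ f : Path w w', γ = Set.range f ∧ γ ⊆ P.Vis w ∪ P.NVis W ∪ P.Vis w'

/-- Adjacency in the neighbor witness graph `GCon(W)`. -/
def GConAdj (P : SimplePolygon) (W : Set Plane) (w w' : Plane) : Prop :=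
  w ∈ W ∧ w' ∈ W ∧ w ≠ w' ∧ ∃ γ : Set Plane, P.IsNWPath W w w' γ

/-- A connected component `NV` of `NVis W` is attached to `Vis w` if the closure of
`NV` intersects `Vis w`. -/
def Attached (P : SimplePolygon) (NV : Set Plane) (w : Plane) : Prop :=
  (closure NV ∩ P.Vis w).Nonempty

/-- `w` is a simplicial vertex of `GCon(W)`: its neighbors are pairwise adjacent. -/
def Simplicial (P : SimplePolygon) (W : Set Plane) (w : Plane) : Prop :=
  ∀ u v : Plane, P.GConAdj W w u → P.GConAdj W w v → u ≠ v → P.GConAdj W u v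

end SimplePolygon

/-- `NV` is a connected component of `S`. -/
def IsCompOf (NV S : Set Plane) : Prop :=
  ∃ x ∈ S, NV = connectedComponentIn S x

/-- Points in one connected subset of the complement of `L` give rise to a continuous
branch of `log ((z - x) / (z - y))` on `L`. -/
theorem exists_continuousOn_log_div {L S : Set ℂ} (hS : IsPreconnected S) (hL : IsClosed L)
    (hSL : S ⊆ Lᶜ) {x y : ℂ} (hx : x ∈ S) (hy : y ∈ S) :
    ∃ g : ℂ → ℂ, ContinuousOn g L ∧ ∀ z ∈ L, Complex.exp (g z) = (z - x) / (z - y) := by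
  have hne : ∀ x ∈ S, ∀ z ∈ L, z - x ≠ 0 := fun x hx z hz h =>
    hSL hx (by rwa [← sub_eq_zero.1 h])
  refine hS.induction₂ (fun x y => ∃ g : ℂ → ℂ, ContinuousOn g L ∧
    ∀ z ∈ L, Complex.exp (g z) = (z - x) / (z - y)) ?_ ?_ ?_ hx hy
  · intro x hx
    obtain ⟨r, hr, hball⟩ := Metric.isOpen_iff.1 hL.isOpen_compl x (hSL hx)
    filter_upwards [inter_mem_nhdsWithin S (Metric.ball_mem_nhds x hr)] with y hy
    have hslit : ∀ z ∈ L, (z - y) / (z - x) ∈ Complex.slitPlane := by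
      intro z hz
      have hzx := hne x hx z hz
      have h1 : r ≤ ‖z - x‖ := by
        by_contra! h
        exact hball (by rwa [Metric.mem_ball, dist_eq_norm]) hz
      have h2 : ‖x - y‖ < r := by
        have := hy.2
        rwa [Metric.mem_ball, dist_comm, dist_eq_norm] at this
      have h3 : (z - y) / (z - x) = 1 + (x - y) / (z - x) := by field_simp; ring
      have h4 : ‖(x - y) / (z - x)‖ < 1 := by
        rw [norm_div, div_lt_one (by positivity)]; linarith
      rw [h3]
      left
      have := (abs_le.1 (Complex.abs_re_le_norm ((x - y) / (z - x)))).1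
      simp only [Complex.add_re, Complex.one_re]
      linarith
    refine ⟨fun z => -Complex.log ((z - y) / (z - x)), ?_, ?_⟩
    · refine (ContinuousOn.clog ?_ hslit).neg
      exact ContinuousOn.div (by fun_prop) (by fun_prop) (hne x hx)
    · intro z hz
      rw [Complex.exp_neg, Complex.exp_log (Complex.slitPlane_ne_zero (hslit z hz)), inv_div]
  · rintro x y z hx hy hz ⟨g, hg, hg'⟩ ⟨h, hh, hh'⟩
    refine ⟨fun z => g z + h z, hg.add hh, fun t ht => ?_⟩
    rw [Complex.exp_add, hg' t ht, hh' t ht]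
    have := hne y hy t ht
    have := hne z hz t ht
    field_simp
  · rintro x y hx hy ⟨g, hg, hg'⟩
    refine ⟨fun z => - g z, hg.neg, fun t ht => ?_⟩
    rw [Complex.exp_neg, hg' t ht, inv_div]

theorem IsPreconnected.eq_of_continuousOn_of_int {X : Type*} [TopologicalSpace X] {S : Set X}
    (hS : IsPreconnected S) {f : X → ℝ} (hf : ContinuousOn f S)
    (hint : ∀ x ∈ S, ∃ n : ℤ, f x = n) {x y : X} (hx : x ∈ S) (hy : y ∈ S) : f x = f y := by
  wlog h : f x < f y generalizing x y
  · rcases eq_or_lt_of_le (not_lt.1 h) with h' | h'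
    · exact h'.symm
    · exact (this hy hx h').symm
  obtain ⟨n, hn⟩ := hint x hx
  obtain ⟨k, hk⟩ := hint y hy
  have hnk : n + 1 ≤ k := by
    rw [hn, hk] at h
    exact_mod_cast h
  have hnk' : (n : ℝ) + 1 ≤ k := by exact_mod_cast hnk
  obtain ⟨z, hz, hfz⟩ := (hS.image f hf).ordConnected.out (mem_image_of_mem f hx)
    (mem_image_of_mem f hy) (show (n : ℝ) + 1 / 2 ∈ Icc (f x) (f y) by
      rw [hn, hk]; constructor <;> linarith)
  obtain ⟨j, hj⟩ := hint z hz
  have h1 : (n : ℝ) < j := by linarith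
  have h2 : (j : ℝ) < n + 1 := by linarith
  have h3 : n < j := by exact_mod_cast h1
  have h4 : j < n + 1 := by exact_mod_cast h2
  omega

/-- A closed set that crosses the segment `[-1, 1]` exactly once, at `0`, and stays connected
without `0`, separates `-1` from `1`. -/
theorem notMem_preconnected_of_crosses {L S : Set ℂ} (hL : IsClosed L)
    (hconn : IsPreconnected (L \ {0})) (h0 : (0 : ℂ) ∈ L)
    (hseg : ∀ s : ℝ, -1 ≤ s → s ≤ 1 → s ≠ 0 → (s : ℂ) ∉ L)
    (hpos : (0 : ℂ) ∈ closure (L ∩ {z | 0 < z.im}))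
    (hneg : (0 : ℂ) ∈ closure (L ∩ {z | z.im < 0}))
    (hS : IsPreconnected S) (hSL : S ⊆ Lᶜ) (h1 : (1 : ℂ) ∈ S) : (-1 : ℂ) ∉ S := by
  intro h1'
  obtain ⟨g, hg, hexp⟩ := exists_continuousOn_log_div hS hL hSL h1 h1'
  set f : ℂ → ℂ := fun z => (z - 1) / (z - -1) with hf
  have hden : ∀ z ∈ L, z - -1 ≠ 0 := fun z hz h => hSL h1' (by rwa [← sub_eq_zero.1 h])
  have hnum : ∀ z ∈ L, z - 1 ≠ 0 := fun z hz h => hSL h1 (by rwa [← sub_eq_zero.1 h])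
  have hfc : ContinuousOn f L := ContinuousOn.div (by fun_prop) (by fun_prop) hden
  have him : ∀ z, (f z).im = 2 * z.im / Complex.normSq (z - -1) := by
    intro z
    simp only [hf, Complex.div_im, Complex.sub_re, Complex.sub_im, Complex.neg_re, Complex.neg_im,
      Complex.one_re, Complex.one_im]
    ring
  have hnsq : ∀ z ∈ L, 0 < Complex.normSq (z - -1) := fun z hz => Complex.normSq_pos.2 (hden z hz)
  have hslit : ∀ z ∈ L \ {0}, f z ∈ Complex.slitPlane := by
    rintro z ⟨hz, hz0⟩
    by_contra hcon
    rw [Complex.mem_slitPlane_iff, not_or, not_lt, not_not] at hcon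
    obtain ⟨hre, him0⟩ := hcon
    rw [him, div_eq_zero_iff] at him0
    have hzim : z.im = 0 := by
      rcases him0 with h | h
      · linarith
      · exact absurd h (hnsq z hz).ne'
    have hzr : z = (z.re : ℂ) := Complex.ext (by simp) (by simp [hzim])
    have hre' : (f z).re = (z.re ^ 2 - 1) / Complex.normSq (z - -1) := by
      simp only [hf, Complex.div_re, Complex.sub_re, Complex.sub_im, Complex.neg_re,
        Complex.neg_im, Complex.one_re, Complex.one_im, hzim]
      ring
    rw [hre', div_nonpos_iff] at hre
    have hsq : z.re ^ 2 ≤ 1 := by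
      rcases hre with h | h
      · exact absurd h.2 (not_le.2 (hnsq z hz))
      · linarith [h.1]
    have := abs_le.1 ((sq_le_one_iff_abs_le_one _).1 hsq)
    refine hseg z.re this.1 this.2 ?_ (hzr ▸ hz)
    intro h
    exact hz0 (by rw [mem_singleton_iff, hzr, h]; simp)
  have hf0 : f 0 = -1 := by simp [hf]
  set ψ : ℂ → ℝ := fun z => ((g z).im - (f z).arg) / (2 * Real.pi) with hψ
  have hψc : ContinuousOn ψ (L \ {0}) := by
    refine ContinuousOn.div_const (ContinuousOn.sub ?_ ?_) _
    · exact Complex.continuous_im.comp_continuousOn (hg.mono sdiff_subset)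
    · intro z hz
      exact (Complex.continuousAt_arg (hslit z hz)).comp_continuousWithinAt
        ((hfc.mono sdiff_subset) z hz)
  have hψint : ∀ z ∈ L \ {0}, ∃ n : ℤ, ψ z = n := by
    intro z hz
    have : Complex.exp (g z) = Complex.exp (Complex.log (f z)) := by
      rw [Complex.exp_log (Complex.slitPlane_ne_zero (hslit z hz)), hexp z hz.1]
    obtain ⟨n, hn⟩ := Complex.exp_eq_exp_iff_exists_int.1 this
    refine ⟨n, ?_⟩
    have h := congrArg Complex.im hn
    simp only [Complex.add_im, Complex.log_im, Complex.mul_im, Complex.intCast_re,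
      Complex.intCast_im, Complex.I_re, Complex.I_im, Complex.mul_re, Complex.re_ofNat,
      Complex.im_ofNat, Complex.ofReal_re, Complex.ofReal_im] at h
    rw [hψ]
    simp only
    rw [h]
    field_simp
    ring
  have lim : ∀ (A : Set ℂ) (B : Set ℂ) (c : ℝ), (0 : ℂ) ∈ closure (L ∩ A) → (0 : ℂ) ∉ A →
      (∀ z ∈ L ∩ A, f z ∈ B) → Filter.Tendsto Complex.arg (nhdsWithin (-1) B) (nhds c) →
      ∃ z₀ ∈ L \ {0}, ψ z₀ = ((g 0).im - c) / (2 * Real.pi) := by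
    intro A B c hcl h0A hAB harg
    have hnb : (nhdsWithin (0 : ℂ) (L ∩ A)).NeBot := mem_closure_iff_nhdsWithin_neBot.1 hcl
    have hsub : L ∩ A ⊆ L \ {0} := fun z hz =>
      ⟨hz.1, fun h => h0A (by rw [← mem_singleton_iff.1 h]; exact hz.2)⟩
    have t1 : Filter.Tendsto (fun z => (g z).im) (nhdsWithin 0 (L ∩ A)) (nhds (g 0).im) :=
      (Complex.continuous_im.tendsto _).comp ((hg 0 h0).mono inter_subset_left)
    have t2 : Filter.Tendsto f (nhdsWithin 0 (L ∩ A)) (nhdsWithin (-1) B) := by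
      rw [← hf0]
      exact tendsto_nhdsWithin_of_tendsto_nhds_of_eventually_within _
        ((hfc 0 h0).mono inter_subset_left)
        (by filter_upwards [self_mem_nhdsWithin] with z hz using hAB z hz)
    have t3 := (t1.sub (harg.comp t2)).div_const (2 * Real.pi)
    obtain ⟨z₀, hz₀⟩ : (L ∩ A).Nonempty := closure_nonempty_iff.1 ⟨0, hcl⟩
    refine ⟨z₀, hsub hz₀, ?_⟩
    refine tendsto_nhds_unique (f := ψ) ?_ t3
    refine (tendsto_const_nhds (x := ψ z₀)).congr' ?_
    filter_upwards [self_mem_nhdsWithin] with z hz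
    exact hconn.eq_of_continuousOn_of_int hψc hψint (hsub hz₀) (hsub hz)
  obtain ⟨z₁, hz₁, e₁⟩ := lim _ {z | 0 ≤ z.im} Real.pi hpos (by simp)
    (fun z hz => by
      have h1 := hnsq z hz.1
      have h2 : 0 < z.im := hz.2
      simp only [mem_ofPred_eq, him]; positivity)
    (by
      have := Complex.tendsto_arg_nhdsWithin_im_nonneg_of_re_neg_of_im_zero
        (z := -1) (by simp) (by simp)
      exact this)
  obtain ⟨z₂, hz₂, e₂⟩ := lim _ {z | z.im < 0} (-Real.pi) hneg (by simp)
    (fun z hz => by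
      have h1 := hnsq z hz.1
      have h2 : z.im < 0 := hz.2
      simp only [mem_ofPred_eq, him]
      exact div_neg_of_neg_of_pos (by linarith) h1)
    (Complex.tendsto_arg_nhdsWithin_im_neg_of_re_neg_of_im_zero (by simp) (by simp))
  have := hconn.eq_of_continuousOn_of_int hψc hψint hz₁ hz₂
  rw [e₁, e₂] at this
  have hpi := Real.pi_pos
  field_simp at this
  linarith

/-- The two-dimensional cross product. -/
def wedge (u v : Plane) : ℝ := u 0 * v 1 - u 1 * v 0

theorem wedge_add_left (u v z : Plane) : wedge (u + v) z = wedge u z + wedge v z := by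
  simp [wedge]; ring

theorem wedge_add_right (u v z : Plane) : wedge z (u + v) = wedge z u + wedge z v := by
  simp [wedge]; ring

theorem wedge_sub_right (u v z : Plane) : wedge z (u - v) = wedge z u - wedge z v := by
  simp [wedge]; ring

theorem wedge_smul_left (t : ℝ) (u v : Plane) : wedge (t • u) v = t * wedge u v := by
  simp [wedge]; ring

theorem wedge_smul_right (t : ℝ) (u v : Plane) : wedge u (t • v) = t * wedge u v := by
  simp [wedge]; ring

theorem wedge_self (u : Plane) : wedge u u = 0 := by
  simp [wedge]; ring

theorem wedge_swap (u v : Plane) : wedge u v = -wedge v u := by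
  simp [wedge]; ring

theorem wedge_smul_decomp (u v z : Plane) :
    wedge u v • z = wedge z v • u + wedge u z • v := by
  ext i
  fin_cases i <;> simp [wedge] <;> ring

theorem continuous_wedge_right (u : Plane) : Continuous (wedge u) := by
  unfold wedge; fun_prop

theorem continuous_wedge_left (u : Plane) : Continuous (fun z => wedge z u) := by
  unfold wedge; fun_prop

theorem exists_smul_of_wedge_eq_zero {u v : Plane} (hu : u ≠ 0) (h : wedge u v = 0) :
    ∃ t : ℝ, v = t • u := by
  have hn : u 0 ≠ 0 ∨ u 1 ≠ 0 := by
    by_contra! hcon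
    exact hu (by ext i; fin_cases i <;> simp [hcon.1, hcon.2])
  unfold wedge at h
  rcases hn with hn | hn
  · refine ⟨v 0 / u 0, ?_⟩
    ext i; fin_cases i <;> simp <;> field_simp
    linarith
  · refine ⟨v 1 / u 1, ?_⟩
    ext i; fin_cases i <;> simp <;> field_simp
    linarith

/-- The point with coordinates `(a, b)` in the affine frame `(w; e, f)`. -/
def framePoint (w e f : Plane) (a b : ℝ) : Plane := w + a • e + b • f

theorem continuous_framePoint (w e f : Plane) :
    Continuous (fun p : ℝ × ℝ => framePoint w e f p.1 p.2) := by
  unfold framePoint; fun_prop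

theorem framePoint_inj {w e f : Plane} (h : wedge e f ≠ 0) {a b a' b' : ℝ}
    (heq : framePoint w e f a b = framePoint w e f a' b') : a = a' ∧ b = b' := by
  have h0 : a • e + b • f = a' • e + b' • f := by
    simpa [framePoint, add_assoc] using heq
  constructor
  · have := congrArg (fun z => wedge z f) h0
    simpa [wedge_add_left, wedge_smul_left, wedge_self, h] using this
  · have := congrArg (wedge e) h0
    simpa [wedge_add_right, wedge_smul_right, wedge_self, h] using this

theorem eq_framePoint (w : Plane) {e f : Plane} (h : wedge e f ≠ 0) (z : Plane) :
    z = framePoint w e f (wedge (z - w) f / wedge e f) (wedge e (z - w) / wedge e f) := by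
  have h1 := wedge_smul_decomp e f (z - w)
  have h2 : z - w = (wedge e f)⁻¹ • (wedge (z - w) f • e + wedge e (z - w) • f) := by
    rw [← h1, smul_smul, inv_mul_cancel₀ h, one_smul]
  rw [framePoint, add_assoc, ← sub_eq_iff_eq_add', div_eq_inv_mul, div_eq_inv_mul, mul_smul,
    mul_smul, ← smul_add]
  exact h2

/-- A closed set that crosses the segment `[m - e, m + e]` exactly once, at `m`, along the
direction `f`, and stays connected without `m`, separates `m - e` from `m + e`. -/
theorem sub_notMem_preconnected_of_crosses {L S : Set Plane} {m e f : Plane}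
    (hef : wedge e f ≠ 0) (hL : IsClosed L) (hconn : IsPreconnected (L \ {m}))
    (hseg : ∀ s : ℝ, -1 ≤ s → s ≤ 1 → s ≠ 0 → m + s • e ∉ L)
    {r : ℝ} (hr : 0 < r) (hloc : ∀ t : ℝ, |t| < r → m + t • f ∈ L)
    (hS : IsPreconnected S) (hSL : S ⊆ Lᶜ) (h1 : m + e ∈ S) : m - e ∉ S := by
  intro h2
  set F : ℂ → Plane := fun z => framePoint m e f z.re z.im with hF
  set G : Plane → ℂ := fun z =>
    ⟨wedge (z - m) f / wedge e f, wedge e (z - m) / wedge e f⟩ with hG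
  have hFc : Continuous F := (continuous_framePoint m e f).comp
    (Complex.continuous_re.prodMk Complex.continuous_im)
  have hGc : Continuous G := by
    have : G = fun z => ((wedge (z - m) f / wedge e f : ℝ) : ℂ) +
        ((wedge e (z - m) / wedge e f : ℝ) : ℂ) * Complex.I := by
      funext z; exact Complex.mk_eq_add_mul_I _ _
    rw [this]
    have c1 := (continuous_wedge_left f).comp (continuous_id.sub (continuous_const (y := m)))
    have c2 := (continuous_wedge_right e).comp (continuous_id.sub (continuous_const (y := m)))
    exact (Complex.continuous_ofReal.comp (c1.div_const _)).add
      ((Complex.continuous_ofReal.comp (c2.div_const _)).mul continuous_const)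
  have hFG : ∀ z, F (G z) = z := fun z => (eq_framePoint m hef z).symm
  have hGF : ∀ z, G (F z) = z := by
    intro z
    have := framePoint_inj hef (hFG (F z))
    exact Complex.ext this.1 this.2
  have hF0 : F 0 = m := by simp [hF, framePoint]
  have himg : ∀ T : Set Plane, G '' T = F ⁻¹' T := fun T =>
    congrFun (image_eq_preimage_of_inverse hFG hGF) T
  have hlim : ∀ c : ℝ, c ≠ 0 → (0 : ℂ) ∈ closure (F ⁻¹' L ∩ {z | 0 < c * z.im}) := by
    intro c hc
    rw [Metric.mem_closure_iff]
    intro ε hε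
    set τ := min ε r / 2 with hτ
    have hτ0 : 0 < τ := by positivity
    have hτr : τ < r := by have := min_le_right ε r; linarith
    have hτε : τ < ε := by have := min_le_left ε r; linarith
    have habs : |SignType.sign c * τ| = τ := by
      rcases lt_or_gt_of_ne hc with h | h
      · simp [sign_neg h, abs_of_pos hτ0]
      · simp [sign_pos h, abs_of_pos hτ0]
    refine ⟨⟨0, SignType.sign c * τ⟩, ⟨?_, ?_⟩, ?_⟩
    · have := hloc (SignType.sign c * τ) (by rwa [habs])
      simpa [hF, framePoint] using this
    · have : c * (SignType.sign c * τ) = |c| * τ := by rw [← mul_assoc, self_mul_sign]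
      simp only [mem_ofPred_eq, this]
      positivity
    · rw [dist_comm, dist_zero_right, ← Complex.abs_im_eq_norm.2 rfl]
      simpa [habs] using hτε
  refine notMem_preconnected_of_crosses (L := F ⁻¹' L) (S := F ⁻¹' S) (hL.preimage hFc) ?_ ?_ ?_
    ?_ ?_ ?_ ?_ ?_ ?_
  · have : F ⁻¹' L \ {0} = G '' (L \ {m}) := by
      rw [himg]
      ext z
      simp only [mem_sdiff, mem_preimage, mem_singleton_iff, ← hF0]
      have : F z = F 0 ↔ z = 0 := ⟨fun h => by rw [← hGF z, h, hGF], fun h => by rw [h]⟩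
      rw [this]
    rw [this]
    exact hconn.image G hGc.continuousOn
  · simpa [hF0] using hloc 0 (by simpa using hr)
  · intro s hs1 hs2 hs0 hmem
    exact hseg s hs1 hs2 hs0 (by simpa [hF, framePoint] using hmem)
  · simpa using hlim 1 one_ne_zero
  · simpa using hlim (-1) (by norm_num)
  · rw [← himg]; exact hS.image G hGc.continuousOn
  · exact fun z hz => hSL hz
  · simpa [hF, framePoint] using h1
  · simpa [hF, framePoint, sub_eq_add_neg] using h2

/-- The set of points that `w` sees within `P`. -/
def visIn (P : Set Plane) (w : Plane) : Set Plane := {x | segment ℝ w x ⊆ P}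

theorem add_smul_sub_mem_segment (x y : Plane) {t : ℝ} (h0 : 0 ≤ t) (h1 : t ≤ 1) :
    x + t • (y - x) ∈ segment ℝ x y := by
  rw [segment_eq_image']; exact ⟨t, ⟨h0, h1⟩, rfl⟩

theorem mem_visIn_iff {P : Set Plane} {w x : Plane} :
    x ∈ visIn P w ↔ ∀ t : ℝ, 0 ≤ t → t ≤ 1 → w + t • (x - w) ∈ P := by
  simp only [visIn, mem_ofPred_eq, segment_eq_image', image_subset_iff]
  exact ⟨fun h t h0 h1 => h ⟨h0, h1⟩, fun h t ht => h t ht.1 ht.2⟩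

theorem mem_of_mem_visIn {P : Set Plane} {w x : Plane} (h : x ∈ visIn P w) : x ∈ P :=
  h (right_mem_segment ℝ w x)

theorem mem_visIn_of_mem_segment {P : Set Plane} {w x y : Plane} (h : x ∈ visIn P w)
    (hy : y ∈ segment ℝ w x) : y ∈ visIn P w :=
  ((convex_segment w x).segment_subset (left_mem_segment ℝ w x) hy).trans h

theorem add_smul_mem_visIn {P : Set Plane} {w v : Plane} {s t : ℝ} (h : w + t • v ∈ visIn P w)
    (hs : 0 ≤ s) (hst : s ≤ t) : w + s • v ∈ visIn P w := by
  rcases hs.eq_or_lt with rfl | hs'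
  · exact mem_visIn_of_mem_segment h (by simp [left_mem_segment])
  · have ht : 0 < t := hs'.trans_le hst
    have := add_smul_sub_mem_segment w (w + t • v) (div_nonneg hs ht.le) ((div_le_one ht).2 hst)
    rw [add_sub_cancel_left, smul_smul, div_mul_cancel₀ _ ht.ne'] at this
    exact mem_visIn_of_mem_segment h this

theorem isClosed_visIn {P : Set Plane} (hP : IsClosed P) (w : Plane) : IsClosed (visIn P w) := by
  have : visIn P w = ⋂ t ∈ Icc (0 : ℝ) 1, (fun x => w + t • (x - w)) ⁻¹' P := by
    ext x
    simp only [mem_visIn_iff, mem_iInter, mem_preimage, mem_Icc, and_imp]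
  rw [this]
  exact isClosed_biInter fun t _ => hP.preimage (by fun_prop)

theorem isPreconnected_image_ray (w v : Plane) {I : Set ℝ} (hI : IsPreconnected I) :
    IsPreconnected ((fun t : ℝ => w + t • v) '' I) :=
  hI.image _ (by fun_prop)

/-- A point on a ray from `w` is connected to the complement of `P` by following the ray,
avoiding a set `L` that meets the region visible from `w` only outside of the ray. -/
theorem exists_preconnected_meets_compl {P L T : Set Plane} (hP : IsClosed P)
    (hPb : Bornology.IsBounded P) (hL : IsClosed L) {w v : Plane} (hv : v ≠ 0)
    (hLT : L ∩ visIn P w ⊆ T) {s₀ : ℝ} (hs1 : s₀ < 1)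
    (hz : w + s₀ • v ∈ visIn P w) (hT : ∀ s, s₀ < s → w + s • v ∉ T)
    (hLs : ∀ s, s₀ < s → s ≤ 1 → w + s • v ∉ L) :
    ∃ S : Set Plane, IsPreconnected S ∧ S ⊆ Lᶜ ∧ w + v ∈ S ∧ ∃ u ∈ S, u ∈ Pᶜ := by
  by_cases hx : w + v ∈ visIn P w
  · set I : Set ℝ := {t | w + t • v ∈ visIn P w} with hI
    have hIc : IsClosed I := (isClosed_visIn hP w).preimage (by fun_prop)
    have h1I : (1 : ℝ) ∈ I := by simpa [hI] using hx
    have hIb : BddAbove I := by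
      obtain ⟨R, hR⟩ := hPb.subset_closedBall w
      refine ⟨R / ‖v‖, fun t ht => ?_⟩
      have := hR (mem_of_mem_visIn ht)
      rw [Metric.mem_closedBall, dist_eq_norm, add_sub_cancel_left, norm_smul] at this
      rw [le_div_iff₀ (norm_pos_iff.2 hv)]
      exact (mul_le_mul_of_nonneg_right (le_abs_self t) (norm_nonneg v)).trans this
    set t₀ := sSup I with ht₀
    have ht₀I : t₀ ∈ I := hIc.csSup_mem ⟨1, h1I⟩ hIb
    have h1t : 1 ≤ t₀ := le_csSup hIb h1I
    have hIL : ∀ t ∈ I, s₀ < t → w + t • v ∉ L := fun t ht hst htL => hT t hst (hLT ⟨htL, ht⟩)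
    have hopen : ∀ᶠ t in nhds t₀, w + t • v ∉ L := by
      have : IsOpen ((fun t : ℝ => w + t • v) ⁻¹' Lᶜ) := hL.isOpen_compl.preimage (by fun_prop)
      exact this.mem_nhds (hIL t₀ ht₀I (by linarith))
    obtain ⟨ε, hε, hball⟩ := Metric.eventually_nhds_iff.1 hopen
    have hnot : t₀ + ε / 2 ∉ I := fun h => by
      have := le_csSup hIb h
      linarith
    rw [hI, mem_ofPred_eq, mem_visIn_iff] at hnot
    push Not at hnot
    obtain ⟨s, hs0', hs1', hsP⟩ := hnot
    rw [add_sub_cancel_left, smul_smul] at hsP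
    set t₁ := s * (t₀ + ε / 2) with ht₁
    have ht₁le : t₁ ≤ t₀ + ε / 2 := by
      have : 0 ≤ t₀ + ε / 2 := by linarith
      nlinarith
    have ht₁0 : 0 ≤ t₁ := mul_nonneg hs0' (by linarith)
    have ht₀₁ : t₀ < t₁ := by
      by_contra! h
      exact hsP (mem_of_mem_visIn (add_smul_mem_visIn ht₀I ht₁0 h))
    refine ⟨(fun t : ℝ => w + t • v) '' Icc 1 t₁, isPreconnected_image_ray w v isPreconnected_Icc,
      ?_, ⟨1, ⟨le_rfl, by linarith⟩, by simp⟩, _, ⟨t₁, ⟨by linarith, le_rfl⟩, rfl⟩, hsP⟩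
    rintro _ ⟨t, ht, rfl⟩
    rcases le_or_gt t t₀ with h | h
    · exact hIL t (add_smul_mem_visIn ht₀I (by linarith [ht.1]) h) (by linarith [ht.1])
    · exact hball (by rw [Real.dist_eq, abs_lt]; constructor <;> linarith [ht.2])
  · rw [mem_visIn_iff] at hx
    push Not at hx
    obtain ⟨s, hs0', hs1', hsP⟩ := hx
    rw [add_sub_cancel_left] at hsP
    have hs : s₀ < s := by
      by_contra! h
      exact hsP (mem_of_mem_visIn (add_smul_mem_visIn hz hs0' h))
    refine ⟨(fun t : ℝ => w + t • v) '' Icc s 1, isPreconnected_image_ray w v isPreconnected_Icc,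
      ?_, ⟨1, ⟨hs1', le_rfl⟩, by simp⟩, _, ⟨s, ⟨le_rfl, hs1'⟩, rfl⟩, hsP⟩
    rintro _ ⟨t, ht, rfl⟩
    exact hLs t (by linarith [ht.1]) ht.2

/-- The segment from `c` to `q` lies in `P` and leaves the region visible from `w` at `c`. -/
structure IsExit (P : Set Plane) (w c q : Plane) : Prop where
  mem : c ∈ visIn P w
  subset : segment ℝ c q ⊆ P
  not_mem : ∀ t : ℝ, 0 < t → t ≤ 1 → c + t • (q - c) ∉ visIn P w

namespace IsExit

variable {P : Set Plane} {w c q : Plane}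

theorem eq_of_mem_segment {P : Set Plane} {w c q z : Plane} (h : IsExit P w c q)
    (hz : z ∈ segment ℝ c q) (hzv : z ∈ visIn P w) : z = c := by
  rw [segment_eq_image'] at hz
  obtain ⟨t, ht, rfl⟩ := hz
  rcases ht.1.eq_or_lt with h0 | h0
  · simp [← h0]
  · exact absurd hzv (h.not_mem t h0 ht.2)

theorem wedge_ne_zero (h : IsExit P w c q) : wedge (c - w) (q - c) ≠ 0 := by
  intro h0
  have hq : q ∉ visIn P w := by simpa using h.not_mem 1 one_pos le_rfl
  have hw : w ∈ visIn P w := mem_visIn_of_mem_segment h.mem (left_mem_segment ℝ w c)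
  have hcw : c - w ≠ 0 := fun h' => hq (by
    rw [sub_eq_zero] at h'
    have := h.subset
    rwa [h'] at this)
  obtain ⟨t, ht⟩ := exists_smul_of_wedge_eq_zero hcw h0
  have hqe : q = c + t • (c - w) := by rw [← ht]; abel
  rcases le_or_gt (-1) t with h1 | h1
  · apply hq
    rw [mem_visIn_iff]
    intro s hs0 hs1
    have e : w + s • (q - w) = w + (s * (1 + t)) • (c - w) := by rw [hqe]; module
    rw [e]
    rcases le_or_gt (s * (1 + t)) 1 with h2 | h2
    · exact h.mem (add_smul_sub_mem_segment w c (mul_nonneg hs0 (by linarith)) h2)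
    · have ht0 : 0 < t := by nlinarith
      have := h.subset (add_smul_sub_mem_segment c q (t := (s * (1 + t) - 1) / t)
        (div_nonneg (by linarith) ht0.le) (by rw [div_le_one ht0]; nlinarith))
      convert this using 1
      rw [hqe, add_sub_cancel_left, smul_smul, div_mul_cancel₀ _ ht0.ne']
      module
  · refine h.not_mem (-1 / t) (div_pos_of_neg_of_neg (by norm_num) (by linarith))
      ((div_le_one_of_neg (by linarith)).2 h1.le) ?_
    rw [ht, smul_smul, div_mul_cancel₀ _ (by linarith : t ≠ 0)]
    simpa using hw

end IsExit

theorem exists_frame_box_disjoint {Z : Set Plane} (hZ : IsClosed Z) {w c : Plane} (f : Plane)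
    (h : Disjoint (segment ℝ w c) Z) :
    ∃ ε : ℝ, 0 < ε ∧ ∀ a b, 0 ≤ a → a ≤ 1 + ε → 0 ≤ b → b ≤ ε →
      framePoint w (c - w) f a b ∉ Z := by
  have key : ∀ᶠ p : ℝ × ℝ in nhds 0, ∀ s ∈ Icc (0 : ℝ) 1,
      framePoint w (c - w) f (s + p.1) p.2 ∉ Z := by
    refine isCompact_Icc.eventually_forall_of_forall_eventually fun s hs => ?_
    have hc : Continuous fun z : (ℝ × ℝ) × ℝ => framePoint w (c - w) f (z.2 + z.1.1) z.1.2 := by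
      unfold framePoint; fun_prop
    refine (hZ.isOpen_compl.preimage hc).mem_nhds ?_
    have := h.notMem_of_mem_left (add_smul_sub_mem_segment w c hs.1 hs.2)
    simpa [framePoint] using this
  obtain ⟨r, hr, hball⟩ := Metric.eventually_nhds_iff.1 key
  refine ⟨r / 2, by positivity, fun a b ha0 ha1 hb0 hb1 => ?_⟩
  have h1 : a - min a 1 ≤ r / 2 := by
    rcases min_cases a 1 with ⟨h, _⟩ | ⟨h, _⟩ <;> rw [h] <;> linarith
  have h2 : 0 ≤ a - min a 1 := by linarith [min_le_left a 1]
  have := hball (y := (a - min a 1, b)) (by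
    rw [Prod.dist_eq, max_lt_iff]
    simp only [Prod.fst_zero, Prod.snd_zero, Real.dist_eq, sub_zero, abs_of_nonneg h2,
      abs_of_nonneg hb0]
    constructor <;> linarith) (min a 1) ⟨le_min ha0 zero_le_one, min_le_right a 1⟩
  simpa using this

theorem IsExit.false_of_frame {P : Set Plane} (hP : IsClosed P) (hPb : Bornology.IsBounded P)
    (hPc : IsPreconnected Pᶜ) {w c₁ q₁ c₂ q₂ : Plane} {K : Set Plane} (hKc : IsClosed K)
    (hK : IsPreconnected K) (hKP : K ⊆ P) (hKw : Disjoint K (visIn P w)) (hq₁ : q₁ ∈ K)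
    (hq₂ : q₂ ∈ K) (h₁ : IsExit P w c₁ q₁) (h₂ : IsExit P w c₂ q₂) {a₂ b₂ : ℝ}
    (hc₂ : c₂ = framePoint w (c₁ - w) (q₁ - c₁) a₂ b₂) (hb₂ : b₂ = 0 → a₂ ≤ 1)
    (hbox : ∃ ε : ℝ, 0 < ε ∧ ∀ a b, 0 ≤ a → a ≤ 1 + ε → 0 ≤ b → b ≤ ε → (0 < b ∨ 1 < a) →
      framePoint w (c₁ - w) (q₁ - c₁) a b ∉ segment ℝ c₂ q₂) : False := by
  have hD := h₁.wedge_ne_zero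
  set e := c₁ - w with he
  set f := q₁ - c₁ with hf
  have he0 : e ≠ 0 := fun h => hD (by simp [h, wedge])
  have inj := @framePoint_inj w e f hD
  have hwP : w ∈ P := h₁.mem (left_mem_segment ℝ w c₁)
  have disj₁ : Disjoint (segment ℝ w c₁) K := Set.disjoint_left.2 fun z hz hzK =>
    hKw.notMem_of_mem_left hzK (mem_visIn_of_mem_segment h₁.mem hz)
  have seg₁ : ∀ z, z ∈ segment ℝ w c₁ ↔ ∃ t : ℝ, 0 ≤ t ∧ t ≤ 1 ∧ z = framePoint w e f t 0 := by
    intro z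
    rw [segment_eq_image']
    constructor
    · rintro ⟨t, ht, rfl⟩; exact ⟨t, ht.1, ht.2, by simp [framePoint, he]⟩
    · rintro ⟨t, h0, h1, rfl⟩; exact ⟨t, ⟨h0, h1⟩, by simp [framePoint, he]⟩
  have segq : ∀ z, z ∈ segment ℝ c₁ q₁ ↔ ∃ t : ℝ, 0 ≤ t ∧ t ≤ 1 ∧ z = framePoint w e f 1 t := by
    intro z
    rw [segment_eq_image']
    constructor
    · rintro ⟨t, ht, rfl⟩; exact ⟨t, ht.1, ht.2, by simp [framePoint, he, hf]⟩
    · rintro ⟨t, h0, h1, rfl⟩; exact ⟨t, ⟨h0, h1⟩, by simp [framePoint, he, hf]⟩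
  have seg₂ : ∀ z, z ∈ segment ℝ w c₂ ↔
      ∃ t : ℝ, 0 ≤ t ∧ t ≤ 1 ∧ z = framePoint w e f (t * a₂) (t * b₂) := by
    intro z
    rw [segment_eq_image', hc₂]
    constructor
    · rintro ⟨t, ht, rfl⟩
      exact ⟨t, ht.1, ht.2, by simp only [framePoint]; module⟩
    · rintro ⟨t, h0, h1, rfl⟩
      exact ⟨t, ⟨h0, h1⟩, by simp only [framePoint]; module⟩
  obtain ⟨ε₁, hε₁, box₁⟩ := exists_frame_box_disjoint hKc f disj₁
  obtain ⟨ε₂, hε₂, box₂⟩ := hbox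
  obtain ⟨δ, hδ0, hδ1, hδε₁, hδε₂⟩ : ∃ δ : ℝ, 0 < δ ∧ δ < 1 ∧ δ ≤ ε₁ ∧ δ ≤ ε₂ := by
    refine ⟨min (1 / 2) (min ε₁ ε₂), by positivity, ?_, ?_, ?_⟩
    · exact (min_le_left _ _).trans_lt (by norm_num)
    · exact (min_le_right _ _).trans (min_le_left _ _)
    · exact (min_le_right _ _).trans (min_le_right _ _)
  obtain ⟨η, hη0, hηδ, hη⟩ : ∃ η : ℝ, 0 < η ∧ η ≤ δ ∧ (b₂ ≤ 0 ∨ a₂ * η < b₂ * (1 - δ)) := by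
    rcases le_or_gt b₂ 0 with h | h
    · exact ⟨δ, hδ0, le_rfl, Or.inl h⟩
    · have hpos : 0 < b₂ * (1 - δ) := mul_pos h (by linarith)
      refine ⟨min δ (b₂ * (1 - δ) / (|a₂| + 1)), by positivity, min_le_left _ _, Or.inr ?_⟩
      set η := min δ (b₂ * (1 - δ) / (|a₂| + 1)) with hη
      have hη0 : 0 < η := by positivity
      have h1 : η * (|a₂| + 1) ≤ b₂ * (1 - δ) :=
        (le_div_iff₀ (by positivity)).1 (min_le_right _ _)
      have h2 : a₂ * η ≤ |a₂| * η := mul_le_mul_of_nonneg_right (le_abs_self _) hη0.le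
      nlinarith
  -- points of the ray `[w, c₂]` lie well to the left of the points used below
  have ray₂ : ∀ t a b : ℝ, 0 ≤ t → 0 < b → t * a₂ = a → t * b₂ = b →
      a * η < b * (1 - δ) := by
    intro t a b ht hb hta htb
    have ht0 : 0 < t := ht.lt_of_ne (by rintro rfl; simp at htb; linarith)
    have hb2 : 0 < b₂ := by
      by_contra! h
      nlinarith
    rcases hη with h | h
    · linarith
    · rw [← hta, ← htb]
      nlinarith
  set T := segment ℝ w c₁ ∪ segment ℝ w c₂ with hTdef
  set L := T ∪ segment ℝ c₁ q₁ ∪ segment ℝ c₂ q₂ ∪ K with hLdef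
  have hLc : IsClosed L := by
    have hs : ∀ x y : Plane, IsClosed (segment ℝ x y) := fun x y => (segment_eq_image_lineMap ℝ x y ▸
      (isCompact_Icc.image AffineMap.lineMap_continuous)).isClosed
    exact ((((hs _ _).union (hs _ _)).union (hs _ _)).union (hs _ _)).union hKc
  have hLP : L ⊆ P := by
    rintro z ((((hz | hz) | hz) | hz) | hz)
    · exact h₁.mem hz
    · exact h₂.mem hz
    · exact h₁.subset hz
    · exact h₂.subset hz
    · exact hKP hz
  have hLT : L ∩ visIn P w ⊆ T := by
    rintro z ⟨((hz | hz) | hz) | hz, hzv⟩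
    · exact hz
    · exact Or.inl (h₁.eq_of_mem_segment hz hzv ▸ right_mem_segment ℝ w c₁)
    · exact Or.inr (h₂.eq_of_mem_segment hz hzv ▸ right_mem_segment ℝ w c₂)
    · exact absurd hzv (hKw.notMem_of_mem_left hz)
  have notT : ∀ a b : ℝ, (0 < b ∨ 1 < a) → (∀ t : ℝ, 0 ≤ t → t ≤ 1 → t * a₂ = a → t * b₂ ≠ b) →
      framePoint w e f a b ∉ T := by
    rintro a b hab h (hz | hz)
    · obtain ⟨t, h0, h1, ht⟩ := (seg₁ _).1 hz
      obtain ⟨rfl, rfl⟩ := inj ht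
      rcases hab with h | h <;> linarith
    · obtain ⟨t, h0, h1, ht⟩ := (seg₂ _).1 hz
      obtain ⟨h2, h3⟩ := inj ht
      exact h t h0 h1 h2.symm h3.symm
  have notL : ∀ a b : ℝ, 0 ≤ a → a ≤ 1 + δ → 0 ≤ b → b ≤ δ → (0 < b ∨ 1 < a) → a ≠ 1 →
      (∀ t : ℝ, 0 ≤ t → t ≤ 1 → t * a₂ = a → t * b₂ ≠ b) → framePoint w e f a b ∉ L := by
    rintro a b ha0 ha1 hb0 hb1 hab ha h (((hz | hz) | hz) | hz)
    · exact notT a b hab h hz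
    · obtain ⟨t, h0, h1, ht⟩ := (segq _).1 hz
      exact ha (inj ht).1
    · exact box₂ a b ha0 (by linarith) hb0 (by linarith) hab hz
    · exact box₁ a b ha0 (by linarith) hb0 (by linarith) hz
  -- the point left of the crossing
  obtain ⟨S₁, hS₁, hS₁L, hxS₁, u₁, hu₁S, hu₁⟩ := exists_preconnected_meets_compl hP hPb hLc
    (w := w) (v := (1 - δ) • e + η • f)
    (fun h => by
      have := inj (a := 1 - δ) (b := η) (a' := 0) (b' := 0)
        (by simp only [framePoint, add_assoc, h]; simp)
      linarith [this.2]) hLT (s₀ := 0) one_pos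
    (by simpa [visIn] using hwP)
    (fun s hs => by
      have := notT (s * (1 - δ)) (s * η) (Or.inl (by positivity)) fun t ht _ h1 h2 => by
        have := ray₂ t _ _ ht (by positivity) h1 h2
        linarith
      convert this using 2
      simp only [framePoint]; module)
    (fun s hs hs1 => by
      have := notL (s * (1 - δ)) (s * η) (mul_nonneg hs.le (by linarith)) (by nlinarith)
        (by positivity) (by nlinarith) (Or.inl (by positivity)) (by nlinarith)
        fun t ht _ h1 h2 => by
          have := ray₂ t _ _ ht (by positivity) h1 h2
          linarith
      convert this using 2
      simp only [framePoint]; module)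
  have noforward : ∀ a : ℝ, 1 < a → ∀ t : ℝ, 0 ≤ t → t ≤ 1 → t * a₂ = a → t * b₂ ≠ 0 := by
    intro a ha t h0 h1 hta htb
    have ht : t ≠ 0 := by rintro rfl; simp at hta; linarith
    have := hb₂ ((mul_eq_zero.1 htb).resolve_left ht)
    nlinarith
  -- the point beyond `c₁`
  obtain ⟨S₂, hS₂, hS₂L, hyS₂, u₂, hu₂S, hu₂⟩ := exists_preconnected_meets_compl hP hPb hLc
    (w := w) (v := (1 + δ) • e) (smul_ne_zero (by linarith) he0) hLT (s₀ := 1 / (1 + δ))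
    (by rw [div_lt_one (by linarith)]; linarith)
    (by
      rw [smul_smul, div_mul_cancel₀ _ (by linarith : (1 + δ) ≠ 0), one_smul, he,
        add_sub_cancel]
      exact h₁.mem)
    (fun s hs => by
      have h1 : 1 < s * (1 + δ) := (div_lt_iff₀ (by linarith)).1 hs
      have := notT (s * (1 + δ)) 0 (Or.inr h1) (noforward _ h1)
      convert this using 2
      simp only [framePoint]; module)
    (fun s hs hs1 => by
      have h1 : 1 < s * (1 + δ) := (div_lt_iff₀ (by linarith)).1 hs
      have := notL (s * (1 + δ)) 0 (by linarith) (by nlinarith) le_rfl hδ0.le (Or.inr h1) h1.ne'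
        (noforward _ h1)
      convert this using 2
      simp only [framePoint]; module)
  set V := (fun t : ℝ => w + (1 + δ) • e + t • f) '' Icc 0 η with hV
  have hVL : V ⊆ Lᶜ := by
    rintro _ ⟨t, ht, rfl⟩
    refine notL (1 + δ) t (by linarith) le_rfl ht.1 (ht.2.trans hηδ) (Or.inr (by linarith))
      (by linarith) ?_
    rcases ht.1.eq_or_lt with h0 | h0
    · rw [← h0]
      exact noforward _ (by linarith)
    · intro s hs _ h1 h2
      have := ray₂ s _ _ hs h0 h1 h2
      nlinarith [ht.2]
  have hVc : IsPreconnected V := isPreconnected_image_ray _ _ isPreconnected_Icc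
  have hyV : w + (1 + δ) • e ∈ V := ⟨0, ⟨le_rfl, hη0.le⟩, by simp⟩
  have hS : IsPreconnected (S₁ ∪ Pᶜ ∪ S₂ ∪ V) :=
    ((hS₁.union u₁ hu₁S hu₁ hPc).union u₂ (Or.inr hu₂) hu₂S hS₂).union _ (Or.inr hyS₂) hyV hVc
  have hSL : S₁ ∪ Pᶜ ∪ S₂ ∪ V ⊆ Lᶜ :=
    union_subset (union_subset (union_subset hS₁L (compl_subset_compl.2 hLP)) hS₂L) hVL
  set m := framePoint w e f 1 η with hm
  have hmT : m ∉ T := notT 1 η (Or.inl hη0) fun t ht _ h1 h2 => by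
    have := ray₂ t _ _ ht hη0 h1 h2
    nlinarith
  have hmK : m ∉ K := box₁ 1 η zero_le_one (by linarith) hη0.le (by linarith)
  have hm₂ : m ∉ segment ℝ c₂ q₂ :=
    box₂ 1 η zero_le_one (by linarith) hη0.le (by linarith) (Or.inl hη0)
  have hη1 : η < 1 := by linarith
  have hconn : IsPreconnected (L \ {m}) := by
    have hLeq : L \ {m} = (fun t : ℝ => c₁ + t • f) '' Ico 0 η ∪ segment ℝ w c₁ ∪
        segment ℝ w c₂ ∪ segment ℝ c₂ q₂ ∪ K ∪ (fun t : ℝ => c₁ + t • f) '' Ioc η 1 := by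
      have hfp : ∀ t : ℝ, c₁ + t • f = framePoint w e f 1 t := fun t => by
        simp [framePoint, he]
      ext z
      constructor
      · rintro ⟨((((hz | hz) | hz) | hz) | hz), hzm⟩
        · exact Or.inl (Or.inl (Or.inl (Or.inl (Or.inr hz))))
        · exact Or.inl (Or.inl (Or.inl (Or.inr hz)))
        · obtain ⟨t, h0, h1, rfl⟩ := (segq _).1 hz
          rcases lt_trichotomy t η with h | h | h
          · exact Or.inl (Or.inl (Or.inl (Or.inl (Or.inl ⟨t, ⟨h0, h⟩, hfp t⟩))))
          · exact absurd (by rw [h]; rfl) hzm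
          · exact Or.inr ⟨t, ⟨h, h1⟩, hfp t⟩
        · exact Or.inl (Or.inl (Or.inr hz))
        · exact Or.inl (Or.inr hz)
      · rintro (((((⟨t, ht, rfl⟩ | hz) | hz) | hz) | hz) | ⟨t, ht, rfl⟩)
        · refine ⟨Or.inl (Or.inl (Or.inr ((segq _).2 ⟨t, ht.1, by linarith [ht.2], hfp t⟩))), ?_⟩
          intro h
          have := (inj ((hfp t).symm.trans h)).2
          linarith [ht.2]
        · exact ⟨Or.inl (Or.inl (Or.inl (Or.inl hz))), fun h => hmT (h ▸ Or.inl hz)⟩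
        · exact ⟨Or.inl (Or.inl (Or.inl (Or.inr hz))), fun h => hmT (h ▸ Or.inr hz)⟩
        · exact ⟨Or.inl (Or.inr hz), fun h => hm₂ (h ▸ hz)⟩
        · exact ⟨Or.inr hz, fun h => hmK (h ▸ hz)⟩
        · refine ⟨Or.inl (Or.inl (Or.inr ((segq _).2 ⟨t, by linarith [ht.1], ht.2, hfp t⟩))), ?_⟩
          intro h
          have := (inj ((hfp t).symm.trans h)).2
          linarith [ht.1]
    rw [hLeq]
    have hsc : ∀ x y : Plane, IsPreconnected (segment ℝ x y) :=
      fun x y => (convex_segment x y).isPreconnected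
    refine ((((IsPreconnected.union c₁ ?_ ?_ ?_ (hsc _ _)).union w ?_ ?_ (hsc _ _)).union c₂ ?_ ?_
      (hsc _ _)).union q₂ ?_ hq₂ hK).union q₁ ?_ ?_ ?_
    · exact ⟨0, ⟨le_rfl, hη0⟩, by simp⟩
    · exact right_mem_segment ℝ w c₁
    · exact isPreconnected_image_ray _ _ isPreconnected_Ico
    · exact Or.inr (left_mem_segment ℝ w c₁)
    · exact left_mem_segment ℝ w c₂
    · exact Or.inr (right_mem_segment ℝ w c₂)
    · exact left_mem_segment ℝ c₂ q₂
    · exact Or.inr (right_mem_segment ℝ c₂ q₂)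
    · exact Or.inr hq₁
    · exact ⟨1, ⟨hη1, le_rfl⟩, by simp [hf]⟩
    · exact isPreconnected_image_ray _ _ isPreconnected_Ioc
  refine sub_notMem_preconnected_of_crosses (L := L) (m := m) (e := δ • e) (f := f)
    (by rw [wedge_smul_left]; exact mul_ne_zero hδ0.ne' hD) hLc hconn ?_
    (r := min η (1 - η)) (lt_min hη0 (by linarith)) ?_ hS hSL ?_ ?_
  · intro s hs0 hs1 hs
    have := notL (1 + s * δ) η (by nlinarith) (by nlinarith) hη0.le hηδ (Or.inl hη0)
      (by simp [hs, hδ0.ne']) fun t ht _ h1 h2 => by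
        have := ray₂ t _ _ ht hη0 h1 h2
        have : 0 ≤ η * (δ * (s + 1)) := by
          have : 0 ≤ s + 1 := by linarith
          positivity
        nlinarith
    convert this using 2
    simp only [hm, framePoint]; module
  · intro t ht
    have h1 := abs_lt.1 (ht.trans_le (min_le_left _ _))
    have h2 := abs_lt.1 (ht.trans_le (min_le_right _ _))
    refine Or.inl (Or.inl (Or.inr ((segq _).2 ⟨η + t, by linarith, by linarith, ?_⟩)))
    simp only [hm, framePoint]; module
  · refine Or.inr ⟨η, ⟨hη0.le, le_rfl⟩, ?_⟩
    simp only [hm, framePoint]; module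
  · refine Or.inl (Or.inl (Or.inl ?_))
    convert hxS₁ using 1
    simp only [hm, framePoint]; module

namespace IsExit

theorem wedge_sub_base (w c q : Plane) : wedge (c - w) (q - w) = wedge (c - w) (q - c) := by
  have : q - w = (q - c) + (c - w) := by abel
  rw [this, wedge_add_right, wedge_self, add_zero]

theorem exists_eq_smul {P : Set Plane} (hP : IsClosed P) (hPb : Bornology.IsBounded P)
    (hPc : IsPreconnected Pᶜ) {w c₁ q₁ c₂ q₂ : Plane} {K : Set Plane} (hKc : IsClosed K)
    (hK : IsPreconnected K) (hKP : K ⊆ P) (hKw : Disjoint K (visIn P w)) (hq₁ : q₁ ∈ K)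
    (hq₂ : q₂ ∈ K) (h₁ : IsExit P w c₁ q₁) (h₂ : IsExit P w c₂ q₂) :
    ∃ t : ℝ, 0 < t ∧ c₂ - w = t • (c₁ - w) := by
  have hD := h₁.wedge_ne_zero
  have hc₂ := eq_framePoint w hD c₂
  set a₂ := wedge (c₂ - w) (q₁ - c₁) / wedge (c₁ - w) (q₁ - c₁)
  set b₂ := wedge (c₁ - w) (c₂ - w) / wedge (c₁ - w) (q₁ - c₁)
  by_contra hcon
  have hab : b₂ = 0 → a₂ ≤ 0 := by
    intro hb
    by_contra! ha
    refine hcon ⟨a₂, ha, ?_⟩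
    rw [sub_eq_iff_eq_add', hc₂, hb]
    simp [framePoint]
  refine false_of_frame hP hPb hPc hKc hK hKP hKw hq₁ hq₂ h₁ h₂ hc₂
    (fun hb => (hab hb).trans zero_le_one) ?_
  have hdisj : Disjoint (segment ℝ w c₁) (segment ℝ c₂ q₂) := by
    refine Set.disjoint_left.2 fun z hz hz₂ => ?_
    have hzc := h₂.eq_of_mem_segment hz₂ (mem_visIn_of_mem_segment h₁.mem hz)
    rw [hzc, segment_eq_image'] at hz
    obtain ⟨t, ht, hte⟩ := hz
    have hte' : framePoint w (c₁ - w) (q₁ - c₁) t 0 =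
        framePoint w (c₁ - w) (q₁ - c₁) a₂ b₂ := by
      rw [← hc₂, ← hte]; simp [framePoint]
    obtain ⟨h1, h2⟩ := framePoint_inj hD hte'
    have ht0 : t = 0 := le_antisymm (h1 ▸ hab h2.symm) ht.1
    have hcw : c₂ = w := by rw [← hte, ht0]; simp
    refine h₂.not_mem 1 one_pos le_rfl ?_
    have := h₂.subset
    rw [hcw] at this ⊢
    simpa [visIn] using this
  obtain ⟨ε, hε, hbox⟩ := exists_frame_box_disjoint
    (hZ := (segment_eq_image_lineMap ℝ c₂ q₂ ▸
      (isCompact_Icc.image AffineMap.lineMap_continuous)).isClosed) (q₁ - c₁) hdisj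
  exact ⟨ε, hε, fun a b h0 h1 h2 h3 _ => hbox a b h0 h1 h2 h3⟩

/-- Two exits on the same ray, into the same connected set of points invisible from `w`, lie on
the same side of the ray. -/
theorem wedge_mul_wedge_pos_of_le_one {P : Set Plane} (hP : IsClosed P)
    (hPb : Bornology.IsBounded P)
    (hPc : IsPreconnected Pᶜ) {w c₁ q₁ c₂ q₂ : Plane} {K : Set Plane} (hKc : IsClosed K)
    (hK : IsPreconnected K) (hKP : K ⊆ P) (hKw : Disjoint K (visIn P w)) (hq₁ : q₁ ∈ K)
    (hq₂ : q₂ ∈ K) (h₁ : IsExit P w c₁ q₁) (h₂ : IsExit P w c₂ q₂) {t : ℝ} (ht1 : t ≤ 1)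
    (ht : c₂ - w = t • (c₁ - w)) :
    0 < wedge (c₁ - w) (q₁ - w) * wedge (c₁ - w) (q₂ - w) := by
  have hD := h₁.wedge_ne_zero
  have hD₂ := h₂.wedge_ne_zero
  rw [wedge_sub_base]
  have hq₂e : wedge (c₂ - w) (q₂ - c₂) = t * wedge (c₁ - w) (q₂ - w) := by
    rw [← wedge_sub_base, ht, wedge_smul_left]
  have hne : wedge (c₁ - w) (q₂ - w) ≠ 0 := by
    rw [hq₂e] at hD₂
    exact right_ne_zero_of_mul hD₂
  by_contra! hle
  have hlt := hle.lt_of_ne (mul_ne_zero hD hne)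
  have hc₂ : c₂ = framePoint w (c₁ - w) (q₁ - c₁) t 0 := by
    rw [framePoint, ← ht]; simp
  refine false_of_frame hP hPb hPc hKc hK hKP hKw hq₁ hq₂ h₁ h₂ hc₂ (fun _ => ht1)
    ⟨1, one_pos, fun a b ha _ hb _ hab hmem => ?_⟩
  rw [segment_eq_image'] at hmem
  obtain ⟨s, hs, hse⟩ := hmem
  have hw : b * wedge (c₁ - w) (q₁ - c₁) = s * wedge (c₁ - w) (q₂ - w) := by
    have h := congrArg (fun z => wedge (c₁ - w) (z - w)) hse
    have e1 : c₂ + s • (q₂ - c₂) - w = (1 - s) • (c₂ - w) + s • (q₂ - w) := by module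
    have e2 : framePoint w (c₁ - w) (q₁ - c₁) a b - w = a • (c₁ - w) + b • (q₁ - c₁) := by
      simp only [framePoint]; module
    simp only [e1, e2, ht, wedge_add_right, wedge_smul_right, wedge_self] at h
    linarith
  have hsq : b * wedge (c₁ - w) (q₁ - c₁) ^ 2 ≤ 0 := by
    have : b * wedge (c₁ - w) (q₁ - c₁) ^ 2 =
        s * (wedge (c₁ - w) (q₁ - c₁) * wedge (c₁ - w) (q₂ - w)) := by
      rw [pow_two, ← mul_assoc, hw]; ring
    rw [this]
    exact mul_nonpos_of_nonneg_of_nonpos hs.1 hlt.le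
  have hb0 : b = 0 := by
    have : 0 < wedge (c₁ - w) (q₁ - c₁) ^ 2 := by positivity
    nlinarith
  have hs0 : s = 0 := by
    rw [hb0, zero_mul, eq_comm, mul_eq_zero] at hw
    exact hw.resolve_right hne
  rw [hs0, hb0] at hse
  simp only [zero_smul, add_zero] at hse
  rw [hc₂] at hse
  have := (framePoint_inj hD hse).1
  rcases hab with h | h <;> linarith

theorem wedge_mul_wedge_pos {P : Set Plane} (hP : IsClosed P) (hPb : Bornology.IsBounded P)
    (hPc : IsPreconnected Pᶜ) {w c₁ q₁ c₂ q₂ : Plane} {K : Set Plane} (hKc : IsClosed K)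
    (hK : IsPreconnected K) (hKP : K ⊆ P) (hKw : Disjoint K (visIn P w)) (hq₁ : q₁ ∈ K)
    (hq₂ : q₂ ∈ K) (h₁ : IsExit P w c₁ q₁) (h₂ : IsExit P w c₂ q₂) {t : ℝ} (ht0 : 0 < t)
    (ht : c₂ - w = t • (c₁ - w)) :
    0 < wedge (c₁ - w) (q₁ - w) * wedge (c₁ - w) (q₂ - w) := by
  rcases le_total t 1 with h | h
  · exact wedge_mul_wedge_pos_of_le_one hP hPb hPc hKc hK hKP hKw hq₁ hq₂ h₁ h₂ h ht
  · have := wedge_mul_wedge_pos_of_le_one hP hPb hPc hKc hK hKP hKw hq₂ hq₁ h₂ h₁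
      (inv_le_one_of_one_le₀ h)
      (by rw [ht, smul_smul, inv_mul_cancel₀ ht0.ne', one_smul])
    rw [ht, wedge_smul_left, wedge_smul_left] at this
    have h2 : t * wedge (c₁ - w) (q₂ - w) * (t * wedge (c₁ - w) (q₁ - w)) =
      t ^ 2 * (wedge (c₁ - w) (q₁ - w) * wedge (c₁ - w) (q₂ - w)) := by ring
    rw [h2] at this
    exact pos_of_mul_pos_right this (sq_nonneg t)

end IsExit

theorem isPreconnected_setOf_lt_norm {R : ℝ} (hR : 0 ≤ R) :
    IsPreconnected {x : Plane | R < ‖x‖} := by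
  have hrank : 1 < Module.rank ℝ Plane := by
    rw [← Module.finrank_eq_rank]
    simp
  have himg : {x : Plane | R < ‖x‖} =
      (fun p : ℝ × Plane => p.1 • p.2) '' (Ioi R ×ˢ Metric.sphere 0 1) := by
    ext x
    simp only [mem_ofPred_eq, mem_image, mem_prod, mem_Ioi, mem_sphere_zero_iff_norm, Prod.exists]
    constructor
    · intro hx
      have h0 : ‖x‖ ≠ 0 := (hR.trans_lt hx).ne'
      exact ⟨‖x‖, ‖x‖⁻¹ • x, ⟨hx, by rw [norm_smul, norm_inv, norm_norm, inv_mul_cancel₀ h0]⟩,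
        by rw [smul_smul, mul_inv_cancel₀ h0, one_smul]⟩
    · rintro ⟨t, y, ⟨ht, hy⟩, rfl⟩
      rw [norm_smul, hy, mul_one, Real.norm_eq_abs]
      exact ht.trans_le (le_abs_self t)
  rw [himg]
  exact (isPreconnected_Ioi.prod (isPreconnected_sphere hrank 0 1)).image _
    (by fun_prop)

namespace SimplePolygon

variable (P : SimplePolygon)

theorem isCompact_boundary : IsCompact P.boundary := by
  refine Finset.isCompact_biUnion _ fun i _ => ?_
  rw [segment_eq_image_lineMap]
  exact isCompact_Icc.image AffineMap.lineMap_continuous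

theorem boundary_subset_region : P.boundary ⊆ P.region := subset_union_left

theorem segment_subset_region {i : ℕ} (hi : i < P.n) :
    segment ℝ (P.vertex i) (P.vertex (i + 1)) ⊆ P.region := fun _ hz =>
  P.boundary_subset_region (mem_biUnion (Finset.mem_range.2 hi) hz)

theorem mem_region_iff_of_notMem_boundary {x : Plane} (hx : x ∉ P.boundary) :
    x ∈ P.region ↔ Bornology.IsBounded (connectedComponentIn P.boundaryᶜ x) := by
  simp [region, hx]

/-- A connected set that misses the boundary and meets the polygon lies in the polygon. -/
theorem subset_region_of_isPreconnected {S : Set Plane} (hS : IsPreconnected S)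
    (hSB : S ⊆ P.boundaryᶜ) {x : Plane} (hx : x ∈ S) (hxP : x ∈ P.region) : S ⊆ P.region := by
  intro y hy
  rw [P.mem_region_iff_of_notMem_boundary (hSB hy),
    ← connectedComponentIn_eq (hS.subset_connectedComponentIn hx hSB hy),
    ← P.mem_region_iff_of_notMem_boundary (hSB hx)]
  exact hxP

theorem isClosed_region : IsClosed P.region := by
  rw [← isOpen_compl_iff, isOpen_iff_forall_mem_open]
  intro x hx
  have hxB : x ∉ P.boundary := fun h => hx (P.boundary_subset_region h)
  have hopen : IsOpen P.boundaryᶜ := P.isCompact_boundary.isClosed.isOpen_compl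
  refine ⟨connectedComponentIn P.boundaryᶜ x, fun y hy hyP => ?_, hopen.connectedComponentIn,
    mem_connectedComponentIn hxB⟩
  exact hx (P.subset_region_of_isPreconnected isPreconnected_connectedComponentIn
    (connectedComponentIn_subset _ _) hy hyP (mem_connectedComponentIn hxB))

theorem exists_lt_norm_subset_compl_boundary :
    ∃ R : ℝ, 0 ≤ R ∧ {x : Plane | R < ‖x‖} ⊆ P.boundaryᶜ := by
  obtain ⟨R, hR⟩ := P.isCompact_boundary.isBounded.subset_closedBall 0
  refine ⟨max R 0, le_max_right _ _, fun x hx hxB => ?_⟩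
  have h1 := hR hxB
  rw [mem_closedBall_zero_iff] at h1
  exact absurd hx (not_lt.2 (h1.trans (le_max_left _ _)))

theorem notMem_region_of_lt_norm {R : ℝ} (hR0 : 0 ≤ R)
    (hR : {x : Plane | R < ‖x‖} ⊆ P.boundaryᶜ) {x : Plane} (hx : R < ‖x‖) : x ∉ P.region := by
  rw [P.mem_region_iff_of_notMem_boundary (hR hx)]
  intro hb
  have hsub := (isPreconnected_setOf_lt_norm hR0).subset_connectedComponentIn
    (show x ∈ {x : Plane | R < ‖x‖} from hx) hR
  obtain ⟨M, hM⟩ := (hb.subset hsub).subset_closedBall 0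
  have hx0 : 0 < ‖x‖ := hR0.trans_lt hx
  have hmem : (((|M| + R + 1) / ‖x‖) • x : Plane) ∈ {x : Plane | R < ‖x‖} := by
    rw [mem_ofPred_eq, norm_smul, norm_div, norm_norm, div_mul_cancel₀ _ hx0.ne',
      Real.norm_eq_abs]
    exact lt_of_lt_of_le (by linarith [abs_nonneg M]) (le_abs_self _)
  have := hM hmem
  rw [mem_closedBall_zero_iff, norm_smul, norm_div, norm_norm, div_mul_cancel₀ _ hx0.ne',
      Real.norm_eq_abs] at this
  linarith [le_abs_self (|M| + R + 1), le_abs_self M]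

theorem isBounded_region : Bornology.IsBounded P.region := by
  obtain ⟨R, hR0, hR⟩ := P.exists_lt_norm_subset_compl_boundary
  refine (Metric.isBounded_closedBall (x := (0 : Plane)) (r := R)).subset fun x hx => ?_
  rw [mem_closedBall_zero_iff]
  by_contra! h
  exact P.notMem_region_of_lt_norm hR0 hR h hx

theorem isPreconnected_compl_region : IsPreconnected P.regionᶜ := by
  obtain ⟨R, hR0, hR⟩ := P.exists_lt_norm_subset_compl_boundary
  have hout := isPreconnected_setOf_lt_norm hR0
  have hxo : ∀ x ∈ P.regionᶜ, ∃ S ⊆ P.regionᶜ, {x : Plane | R < ‖x‖} ⊆ S ∧ x ∈ S ∧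
      IsPreconnected S := by
    intro x hx
    have hxB : x ∉ P.boundary := fun h => hx (P.boundary_subset_region h)
    have hub : ¬ Bornology.IsBounded (connectedComponentIn P.boundaryᶜ x) := by
      rwa [← P.mem_region_iff_of_notMem_boundary hxB]
    obtain ⟨y, hy, hyR⟩ : ∃ y ∈ connectedComponentIn P.boundaryᶜ x, R < ‖y‖ := by
      by_contra! hcon
      exact hub ((Metric.isBounded_closedBall (x := (0 : Plane)) (r := R)).subset
        fun y hy => mem_closedBall_zero_iff.2 (hcon y hy))
    refine ⟨connectedComponentIn P.boundaryᶜ x, fun z hz hzP => ?_, ?_,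
      mem_connectedComponentIn hxB, isPreconnected_connectedComponentIn⟩
    · exact hx (P.subset_region_of_isPreconnected isPreconnected_connectedComponentIn
        (connectedComponentIn_subset _ _) hz hzP (mem_connectedComponentIn hxB))
    · rw [connectedComponentIn_eq hy]
      exact hout.subset_connectedComponentIn hyR hR
  refine isPreconnected_of_forall_pair fun x hx y hy => ?_
  obtain ⟨S, hS, hSo, hxS, hSc⟩ := hxo x hx
  obtain ⟨T, hT, hTo, hyT, hTc⟩ := hxo y hy
  obtain ⟨z, hz⟩ : ∃ z : Plane, R < ‖z‖ := by
    obtain ⟨z, hz⟩ := NormedSpace.exists_lt_norm ℝ Plane R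
    exact ⟨z, hz⟩
  exact ⟨S ∪ T, union_subset hS hT, Or.inl hxS, Or.inr hyT,
    hSc.union z (hSo hz) (hTo hz) hTc⟩

theorem mem_boundary_iff {z : Plane} :
    z ∈ P.boundary ↔ ∃ i < P.n, z ∈ segment ℝ (P.vertex i) (P.vertex (i + 1)) := by
  simp [boundary]

theorem vertex_mod (i : ℕ) : P.vertex (i % P.n) = P.vertex i :=
  Function.Periodic.map_mod_nat P.periodic i

theorem n_pos : 0 < P.n := by have := P.three_le; omega

theorem vertex_mem_boundary (i : ℕ) : P.vertex i ∈ P.boundary := by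
  rw [← P.vertex_mod]
  exact P.mem_boundary_iff.2 ⟨_, Nat.mod_lt _ P.n_pos, left_mem_segment ℝ _ _⟩

theorem vertex_succ_sub_ne_zero {i : ℕ} (hi : i < P.n) :
    P.vertex (i + 1) - P.vertex i ≠ 0 := by
  rw [sub_ne_zero, ← P.vertex_mod (i + 1)]
  intro h
  have h3 := P.three_le
  have h' := P.inj _ (Nat.mod_lt _ P.n_pos) _ hi h
  rcases Nat.lt_or_ge (i + 1) P.n with hlt | hge
  · rw [Nat.mod_eq_of_lt hlt] at h'; omega
  · have : i + 1 = P.n := by omega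
    rw [this, Nat.mod_self] at h'; omega

theorem notMem_segment_of_ne {i j : ℕ} (hi : i < P.n) (hj : j < P.n) (hij : i ≠ j) {z : Plane}
    (hz : z ∈ segment ℝ (P.vertex i) (P.vertex (i + 1))) (hv : z ∉ range P.vertex) :
    z ∉ segment ℝ (P.vertex j) (P.vertex (j + 1)) := by
  intro hz'
  have h : z ∈ segment ℝ (P.vertex i) (P.vertex (i + 1)) ∩
    segment ℝ (P.vertex j) (P.vertex (j + 1)) := ⟨hz, hz'⟩
  rw [P.jordan i hi j hj hij] at h
  split_ifs at h
  · exact hv ⟨_, (mem_singleton_iff.1 h).symm⟩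
  · exact hv ⟨_, (mem_singleton_iff.1 h).symm⟩
  · exact h

/-- Near an interior point `z` of an edge, the edge covers its line, and each of the two half
discs cut off by it lies in the polygon as soon as one of its points does. -/
theorem exists_halfDisc {i : ℕ} (hi : i < P.n) {z : Plane}
    (hz : z ∈ segment ℝ (P.vertex i) (P.vertex (i + 1))) (hv : z ∉ range P.vertex) :
    ∃ r > 0, (∀ y ∈ Metric.ball z r, wedge (P.vertex (i + 1) - P.vertex i) (y - z) = 0 →
        y ∈ P.region) ∧
      ∀ y₀ ∈ Metric.ball z r, y₀ ∈ P.region → ∀ y ∈ Metric.ball z r,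
        0 < wedge (P.vertex (i + 1) - P.vertex i) (y₀ - z) *
          wedge (P.vertex (i + 1) - P.vertex i) (y - z) → y ∈ P.region := by
  have he := P.vertex_succ_sub_ne_zero hi
  have hZ : IsClosed (⋃ j ∈ (Finset.range P.n).erase i,
      segment ℝ (P.vertex j) (P.vertex (j + 1))) := by
    refine (Finset.isCompact_biUnion _ fun j _ => ?_).isClosed
    rw [segment_eq_image_lineMap]
    exact isCompact_Icc.image AffineMap.lineMap_continuous
  have hzZ : z ∉ ⋃ j ∈ (Finset.range P.n).erase i,
      segment ℝ (P.vertex j) (P.vertex (j + 1)) := by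
    simp only [mem_iUnion, Finset.mem_erase, Finset.mem_range, not_exists]
    exact fun j hj => P.notMem_segment_of_ne hi hj.2 hj.1.symm hz hv
  obtain ⟨r₁, hr₁, hball⟩ := Metric.isOpen_iff.1 hZ.isOpen_compl z hzZ
  have hz' := hz
  rw [segment_eq_image'] at hz'
  obtain ⟨s, hs, hse⟩ := hz'
  set e := P.vertex (i + 1) - P.vertex i with he_def
  have hs0 : 0 < s := hs.1.lt_of_ne fun h => hv ⟨i, by simpa [← h] using hse⟩
  have hs1 : s < 1 := hs.2.lt_of_ne fun h => hv ⟨i + 1, by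
    rw [← hse, h, he_def]; simp⟩
  have hline : ∀ y ∈ Metric.ball z r₁, y ∈ P.boundary → wedge e (y - z) = 0 := by
    intro y hy hyB
    obtain ⟨j, hj, hyj⟩ := P.mem_boundary_iff.1 hyB
    by_cases hji : j = i
    · subst hji
      rw [segment_eq_image'] at hyj
      obtain ⟨t, -, rfl⟩ := hyj
      have : P.vertex j + t • (P.vertex (j + 1) - P.vertex j) - z = (t - s) • e := by
        rw [← hse]; module
      rw [this, wedge_smul_right, wedge_self, mul_zero]
    · exact absurd (mem_biUnion (Finset.mem_erase.2 ⟨hji, Finset.mem_range.2 hj⟩) hyj) (hball hy)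
  have hen : 0 < ‖e‖ := norm_pos_iff.2 he
  refine ⟨min r₁ (min s (1 - s) * ‖e‖), lt_min hr₁ (mul_pos (lt_min hs0 (by linarith)) hen),
    fun y hy hw => ?_, fun y₀ hy₀ hy₀P y hy hpos => ?_⟩
  · obtain ⟨t, ht⟩ := exists_smul_of_wedge_eq_zero he hw
    rw [Metric.mem_ball, dist_eq_norm, ht, norm_smul, Real.norm_eq_abs, lt_min_iff] at hy
    have hlt := lt_of_mul_lt_mul_right hy.2 hen.le
    rw [lt_min_iff, abs_lt, abs_lt] at hlt
    refine P.segment_subset_region hi ?_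
    have : y = P.vertex i + (s + t) • e := by
      rw [sub_eq_iff_eq_add] at ht
      rw [ht, ← hse]; module
    rw [this]
    exact add_smul_sub_mem_segment _ _ (by linarith [hlt.1.1]) (by linarith [hlt.2.2])
  · have hconv : Convex ℝ (Metric.ball z (min r₁ (min s (1 - s) * ‖e‖)) ∩
        {x | 0 < wedge e (y₀ - z) * wedge e (x - z)}) := by
      refine (convex_ball _ _).inter fun x hx x' hx' a b ha hb hab => ?_
      have h : wedge e (y₀ - z) * wedge e (a • x + b • x' - z) =
          a * (wedge e (y₀ - z) * wedge e (x - z)) +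
            b * (wedge e (y₀ - z) * wedge e (x' - z)) := by
        have : a • x + b • x' - z = a • (x - z) + b • (x' - z) := by
          rw [← eq_sub_iff_add_eq'] at hab
          rw [hab]; module
        rw [this, wedge_add_right, wedge_smul_right, wedge_smul_right]; ring
      rw [mem_ofPred_eq] at hx hx' ⊢
      rw [h]
      rcases ha.eq_or_lt with rfl | ha
      · rw [zero_add] at hab
        simpa [hab] using hx'
      · have := mul_pos ha hx
        have := mul_nonneg hb hx'.le
        linarith
    refine P.subset_region_of_isPreconnected hconv.isPreconnected (x := y₀) ?_ ⟨hy₀, ?_⟩ hy₀P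
      ⟨hy, hpos⟩
    · rintro x ⟨hx, hxp⟩ hxB
      rw [mem_ofPred_eq, hline x (Metric.ball_subset_ball (min_le_left _ _) hx) hxB,
        mul_zero] at hxp
      exact lt_irrefl _ hxp
    · exact mul_self_pos.2 (left_ne_zero_of_mul hpos.ne')

theorem mem_interior_region {z : Plane} (hz : z ∈ P.region) (hzB : z ∉ P.boundary) :
    z ∈ interior P.region := by
  obtain ⟨r, hr, hball⟩ :=
    Metric.isOpen_iff.1 P.isCompact_boundary.isClosed.isOpen_compl z hzB
  exact mem_interior.2 ⟨_, P.subset_region_of_isPreconnected (convex_ball z r).isPreconnected hball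
    (Metric.mem_ball_self hr) hz, Metric.isOpen_ball, Metric.mem_ball_self hr⟩

end SimplePolygon

section

open Filter Topology

namespace SimplePolygon

variable (P : SimplePolygon)

theorem wedge_edge_ne_zero {w p : Plane} (hwB : w ∉ P.boundary) (hpw : p ≠ w)
    (hv : ∀ t : ℝ, 0 ≤ t → t ≤ 1 → w + t • (p - w) ∉ range P.vertex) {i : ℕ} (hi : i < P.n)
    {t : ℝ} (ht0 : 0 ≤ t) (ht1 : t ≤ 1)
    (hz : w + t • (p - w) ∈ segment ℝ (P.vertex i) (P.vertex (i + 1))) :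
    wedge (P.vertex (i + 1) - P.vertex i) (p - w) ≠ 0 := by
  intro h0
  obtain ⟨c, hc⟩ := exists_smul_of_wedge_eq_zero (P.vertex_succ_sub_ne_zero hi) h0
  have hc0 : c ≠ 0 := by
    rintro rfl
    exact hpw (sub_eq_zero.1 (by rw [hc, zero_smul]))
  rw [segment_eq_image'] at hz
  obtain ⟨s, hs, hse⟩ := hz
  set e := P.vertex (i + 1) - P.vertex i with he
  have hpe : e = c⁻¹ • (p - w) := by rw [hc, smul_smul, inv_mul_cancel₀ hc0, one_smul]
  have hw : w = P.vertex i + (s - t * c) • e := by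
    have : w = P.vertex i + s • e - t • (p - w) := by rw [eq_sub_iff_add_eq]; exact hse.symm
    rw [hc] at this
    rw [this]; module
  have hend : ∀ a : ℝ, P.vertex i + a • e = w + (t + (a - s) / c) • (p - w) := by
    intro a
    have : w + (t + (a - s) / c) • (p - w) = w + t • (p - w) + (a - s) • e := by
      rw [hpe, smul_smul]; module
    rw [this, ← hse]; module
  have hv0 : ¬ (0 ≤ t - s / c ∧ t - s / c ≤ 1) := fun h => by
    refine hv (t + (0 - s) / c) ?_ ?_ ⟨i, ?_⟩
    · have : t + (0 - s) / c = t - s / c := by ring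
      linarith
    · have : t + (0 - s) / c = t - s / c := by ring
      linarith
    · rw [← hend]; simp
  have hv1 : ¬ (0 ≤ t + (1 - s) / c ∧ t + (1 - s) / c ≤ 1) := fun h => by
    refine hv _ h.1 h.2 ⟨i + 1, ?_⟩
    rw [← hend, he]; simp
  have hnot : ¬ (0 ≤ s - t * c ∧ s - t * c ≤ 1) := fun h => hwB <| P.mem_boundary_iff.2
    ⟨i, hi, by rw [hw]; exact add_smul_sub_mem_segment _ _ h.1 h.2⟩
  rcases lt_or_ge (s - t * c) 0 with hlt | hge
  · have hcpos : 0 < c := by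
      by_contra! hneg
      nlinarith [hs.1, mul_nonneg ht0 (neg_nonneg.2 hneg)]
    refine hv0 ⟨?_, ?_⟩
    · rw [sub_nonneg, div_le_iff₀ hcpos]; linarith
    · have := div_nonneg hs.1 hcpos.le
      linarith
  · have hgt : 1 < s - t * c := by
      by_contra! hle
      exact hnot ⟨hge, hle⟩
    have hcneg : c < 0 := by
      by_contra! hpos
      nlinarith [hs.2, mul_nonneg ht0 hpos]
    have h1 : (1 - s) / c ≤ 0 := div_nonpos_of_nonneg_of_nonpos (by linarith [hs.2]) hcneg.le
    refine hv1 ⟨?_, by linarith⟩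
    have : -t ≤ (1 - s) / c := by
      rw [le_div_iff_of_neg hcneg]; linarith
    linarith

/-- If the segment from an interior point `w` to a visible point `p` avoids all vertices, then it
can be rotated slightly in both directions inside the polygon. -/
theorem eventually_mem_visIn {w p : Plane} (hwB : w ∉ P.boundary)
    (hp : p ∈ visIn P.region w) (hpw : p ≠ w)
    (hv : ∀ t : ℝ, 0 ≤ t → t ≤ 1 → w + t • (p - w) ∉ range P.vertex) :
    ∃ e : Plane, e ≠ 0 ∧ ∀ᶠ τ : ℝ in 𝓝 0, p + τ • e ∈ visIn P.region w := by
  have hint : ∀ t : ℝ, 0 ≤ t → t < 1 → w + t • (p - w) ∈ interior P.region := by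
    intro t ht0 ht1
    have hmem := mem_visIn_iff.1 hp t ht0 ht1.le
    by_cases hB : w + t • (p - w) ∈ P.boundary
    swap
    · exact P.mem_interior_region hmem hB
    obtain ⟨i, hi, hz⟩ := P.mem_boundary_iff.1 hB
    have hne := P.wedge_edge_ne_zero hwB hpw hv hi ht0 ht1.le hz
    obtain ⟨r, hr, hline, hhalf⟩ := P.exists_halfDisc hi hz (hv t ht0 ht1.le)
    have ht0' : 0 < t := ht0.lt_of_ne fun h => hwB (by simpa [← h] using hB)
    have hcont : Continuous fun a : ℝ => w + a • (p - w) := by fun_prop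
    have hnhds : ∀ᶠ a in 𝓝 t, w + a • (p - w) ∈ Metric.ball (w + t • (p - w)) r ∧
        w + a • (p - w) ∈ P.region := by
      filter_upwards [hcont.continuousAt.eventually_mem (Metric.ball_mem_nhds _ hr),
        Ioo_mem_nhds ht0' ht1] with a ha ha'
      exact ⟨ha, mem_visIn_iff.1 hp a ha'.1.le ha'.2.le⟩
    obtain ⟨ε, hε, hεs⟩ := Metric.eventually_nhds_iff.1 hnhds
    have hside : ∀ δ : ℝ, |δ| < ε → ∀ y ∈ Metric.ball (w + t • (p - w)) r,
        0 < δ * wedge (P.vertex (i + 1) - P.vertex i) (p - w) *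
          wedge (P.vertex (i + 1) - P.vertex i) (y - (w + t • (p - w))) → y ∈ P.region := by
      intro δ hδ y hy hpos
      obtain ⟨h1, h2⟩ := hεs (y := t + δ) (by simpa [Real.dist_eq] using hδ)
      refine hhalf _ h1 h2 y hy ?_
      have : w + (t + δ) • (p - w) - (w + t • (p - w)) = δ • (p - w) := by module
      rwa [this, wedge_smul_right]
    refine mem_interior.2 ⟨_, fun y hy => ?_, Metric.isOpen_ball, Metric.mem_ball_self hr⟩
    by_cases h0 : wedge (P.vertex (i + 1) - P.vertex i) (y - (w + t • (p - w))) = 0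
    · exact hline y hy h0
    have hε2 : 0 < ε / 2 := by positivity
    rcases (mul_ne_zero hne h0).lt_or_gt with h | h
    · refine hside (-(ε / 2)) (by rw [abs_neg, abs_of_pos hε2]; linarith) y hy ?_
      rw [mul_assoc]
      exact mul_pos_of_neg_of_neg (by linarith) h
    · refine hside (ε / 2) (by rw [abs_of_pos hε2]; linarith) y hy ?_
      rw [mul_assoc]
      exact mul_pos hε2 h
  suffices hend : ∃ e : Plane, e ≠ 0 ∧ ∀ᶠ a : ℝ × ℝ in 𝓝 (0, 1), a.2 ≤ 1 →
      w + a.2 • (p + a.1 • e - w) ∈ P.region by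
    obtain ⟨e, he, hend⟩ := hend
    refine ⟨e, he, ?_⟩
    have hcont : Continuous fun a : ℝ × ℝ => w + a.2 • (p + a.1 • e - w) := by fun_prop
    have key : ∀ᶠ τ : ℝ in 𝓝 0, ∀ s ∈ Icc (0 : ℝ) 1, s ≤ 1 →
        w + s • (p + τ • e - w) ∈ P.region := by
      refine isCompact_Icc.eventually_forall_of_forall_eventually fun s hs => ?_
      rcases hs.2.eq_or_lt with rfl | hs1
      · exact hend
      · have hm : w + s • (p + (0 : ℝ) • e - w) ∈ interior P.region := by
          simpa using hint s hs.1 hs1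
        filter_upwards [hcont.continuousAt.eventually_mem
          (x := ((0 : ℝ), s)) (isOpen_interior.mem_nhds hm)] with a ha _
        exact interior_subset ha
    filter_upwards [key] with τ hτ
    exact mem_visIn_iff.2 fun s h0 h1 => hτ s ⟨h0, h1⟩ h1
  have hpe : w + (1 : ℝ) • (p - w) = p := by simp
  have hpP := mem_of_mem_visIn hp
  by_cases hB : p ∈ P.boundary
  swap
  · refine ⟨p - w, sub_ne_zero.2 hpw, ?_⟩
    have hcont : Continuous fun a : ℝ × ℝ => w + a.2 • (p + a.1 • (p - w) - w) := by fun_prop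
    have hm : w + (1 : ℝ) • (p + (0 : ℝ) • (p - w) - w) ∈ interior P.region := by
      simpa using P.mem_interior_region hpP hB
    filter_upwards [hcont.continuousAt.eventually_mem
          (x := ((0 : ℝ), (1 : ℝ))) (isOpen_interior.mem_nhds hm)] with a ha _
    exact interior_subset ha
  obtain ⟨i, hi, hz⟩ := P.mem_boundary_iff.1 hB
  have hne := P.wedge_edge_ne_zero hwB hpw hv hi zero_le_one le_rfl (hpe.symm ▸ hz)
  have hvp := hv 1 zero_le_one le_rfl
  rw [hpe] at hvp
  obtain ⟨r, hr, hline, hhalf⟩ := P.exists_halfDisc hi hz hvp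
  set e := P.vertex (i + 1) - P.vertex i
  have hcont : Continuous fun a : ℝ × ℝ => w + a.2 • (p + a.1 • e - w) := by fun_prop
  obtain ⟨δ, hδ, hδ1, hδr⟩ : ∃ δ : ℝ, 0 < δ ∧ δ ≤ 1 ∧ p + δ • (w - p) ∈ Metric.ball p r := by
    have hc : Continuous fun a : ℝ => p + a • (w - p) := by fun_prop
    have : ∀ᶠ a : ℝ in 𝓝 0, p + a • (w - p) ∈ Metric.ball p r :=
      hc.continuousAt.eventually_mem (by simpa using Metric.ball_mem_nhds p hr)
    obtain ⟨ε, hε, hεs⟩ := Metric.eventually_nhds_iff.1 this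
    have hmin : 0 < min (ε / 2) 1 := lt_min (by positivity) one_pos
    refine ⟨min (ε / 2) 1, hmin, min_le_right _ _, hεs ?_⟩
    rw [Real.dist_eq, sub_zero, abs_of_pos hmin]
    exact (min_le_left _ _).trans_lt (by linarith)
  refine ⟨e, P.vertex_succ_sub_ne_zero hi, ?_⟩
  filter_upwards [hcont.continuousAt.eventually_mem (x := ((0 : ℝ), (1 : ℝ)))
    (by simpa using Metric.ball_mem_nhds p hr),
    (continuous_snd.tendsto ((0 : ℝ), (1 : ℝ))).eventually (lt_mem_nhds zero_lt_one)]
    with a ha ha0 ha1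
  have hwe : wedge e (w + a.2 • (p + a.1 • e - w) - p) = -((1 - a.2) * wedge e (p - w)) := by
    have : w + a.2 • (p + a.1 • e - w) - p = (a.2 - 1) • (p - w) + (a.2 * a.1) • e := by module
    rw [this, wedge_add_right, wedge_smul_right, wedge_smul_right, wedge_self]; ring
  rcases ha1.eq_or_lt with h1 | h1
  · exact hline _ ha (by rw [hwe, h1]; ring)
  · refine hhalf _ hδr ?_ _ ha ?_
    · have := mem_visIn_iff.1 hp (1 - δ) (by linarith) (by linarith)
      convert this using 1
      module
    · have : p + δ • (w - p) - p = (-δ) • (p - w) := by module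
      rw [hwe, this, wedge_smul_right]
      have h2 : -δ * wedge e (p - w) * -((1 - a.2) * wedge e (p - w)) =
        δ * (1 - a.2) * wedge e (p - w) ^ 2 := by ring
      rw [h2]
      have : 0 < 1 - a.2 := by linarith
      positivity

end SimplePolygon

theorem exists_wedge_ne_zero {d : Plane} (hd : d ≠ 0) : ∃ f : Plane, wedge d f ≠ 0 := by
  refine ⟨!₂[-d 1, d 0], fun h => hd ?_⟩
  have h' : d 0 * d 0 + d 1 * d 1 = 0 := by simpa [wedge] using h
  obtain ⟨h0, h1⟩ := (mul_self_add_mul_self_eq_zero).1 h'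
  ext i
  fin_cases i <;> simp [h0, h1]

/-- A compact set has a point where no move along a line increases `wedge d` and, to second order,
`wedge f`. -/
theorem exists_isMax_lex {K : Set Plane} (hK : IsCompact K) (hne : K.Nonempty) {d f : Plane}
    (hdf : wedge d f ≠ 0) {κ : ℝ} (hκ : κ ≠ 0) :
    ∃ p ∈ K, (∀ x ∈ K, κ * wedge d x ≤ κ * wedge d p) ∧
      ∀ e : Plane, e ≠ 0 → ¬ ∀ᶠ τ : ℝ in 𝓝 0, p + τ • e ∈ K := by
  have hg : Continuous fun x => κ * wedge d x := continuous_const.mul (continuous_wedge_right d)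
  obtain ⟨p₀, hp₀, hmax₀⟩ := hK.exists_isMaxOn hne hg.continuousOn
  obtain ⟨p, hp, hmax⟩ := (hK.inter_right (isClosed_singleton.preimage hg)).exists_isMaxOn
    ⟨p₀, hp₀, mem_singleton _⟩ (continuous_wedge_right f).continuousOn
  have hpe : κ * wedge d p = κ * wedge d p₀ := hp.2
  refine ⟨p, hp.1, fun x hx => hpe ▸ hmax₀ hx, fun e he hev => ?_⟩
  obtain ⟨ε, hε, hεs⟩ := Metric.eventually_nhds_iff.1 hev
  have hin : ∀ τ : ℝ, |τ| < ε → p + τ • e ∈ K := fun τ hτ =>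
    hεs (by simpa [Real.dist_eq] using hτ)
  have hε2 : 0 < ε / 2 := by positivity
  have h1 : |ε / 2| < ε := by rw [abs_of_pos hε2]; linarith
  have h2 : |-(ε / 2)| < ε := by rwa [abs_neg]
  have hd0 : wedge d e = 0 := by
    have a1 : κ * wedge d (p + (ε / 2) • e) ≤ κ * wedge d p₀ := hmax₀ (hin _ h1)
    have a2 : κ * wedge d (p + (-(ε / 2)) • e) ≤ κ * wedge d p₀ := hmax₀ (hin _ h2)
    rw [wedge_add_right, wedge_smul_right, mul_add, ← hpe] at a1 a2
    have : ε / 2 * (κ * wedge d e) = 0 := by linarith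
    exact (mul_eq_zero.1 ((mul_eq_zero.1 this).resolve_left hε2.ne')).resolve_left hκ
  have hin' : ∀ τ : ℝ, |τ| < ε → wedge f (p + τ • e) ≤ wedge f p := fun τ hτ =>
    hmax ⟨hin τ hτ, by
      show κ * wedge d (p + τ • e) = _
      rw [wedge_add_right, wedge_smul_right, hd0, mul_zero, add_zero, hpe]⟩
  have hf0 : wedge f e = 0 := by
    have a1 := hin' _ h1
    have a2 := hin' _ h2
    rw [wedge_add_right, wedge_smul_right] at a1 a2
    have : ε / 2 * wedge f e = 0 := by linarith
    exact (mul_eq_zero.1 this).resolve_left hε2.ne'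
  have := wedge_smul_decomp d f e
  rw [hd0, wedge_swap e f, hf0, neg_zero, zero_smul, zero_smul, add_zero] at this
  exact (smul_eq_zero.1 this).elim hdf he

namespace SimplePolygon

variable (P : SimplePolygon)

theorem exists_vertex_mem_visIn_of_notMem_boundary {w : Plane} (hw : w ∈ P.region)
    (hwB : w ∉ P.boundary) {d : Plane} (hd : d ≠ 0) {κ : ℝ} (hκ : κ ≠ 0) :
    ∃ i, P.vertex i ∈ visIn P.region w ∧ 0 < κ * wedge d (P.vertex i - w) := by
  obtain ⟨f, hdf⟩ := exists_wedge_ne_zero hd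
  have hww : w ∈ visIn P.region w := by simpa [visIn] using hw
  have hKc : IsCompact (visIn P.region w) :=
    (Metric.isCompact_of_isClosed_isBounded P.isClosed_region P.isBounded_region).of_isClosed_subset
      (isClosed_visIn P.isClosed_region w) fun _ => mem_of_mem_visIn
  obtain ⟨p, hp, hmax, hnot⟩ := exists_isMax_lex hKc ⟨w, hww⟩ hdf hκ
  by_contra! hcon
  have hpos : 0 < κ * wedge d (p - w) := by
    have h0 := hmax w hww
    have he : κ * wedge d (p - w) = κ * wedge d p - κ * wedge d w := by
      rw [wedge_sub_right]; ring
    refine lt_of_le_of_ne (by linarith) fun h => ?_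
    obtain ⟨r, hr, hball⟩ := Metric.mem_nhds_iff.1
      (mem_interior_iff_mem_nhds.1 (P.mem_interior_region hw hwB))
    have hc : Continuous fun τ : ℝ => w + τ • f := by fun_prop
    obtain ⟨ε, hε, hεs⟩ := Metric.eventually_nhds_iff.1 (hc.continuousAt.eventually_mem (x := 0)
      (by simpa using Metric.ball_mem_nhds w hr))
    have hin : ∀ τ : ℝ, |τ| < ε → κ * wedge d (w + τ • f) ≤ κ * wedge d p := fun τ hτ =>
      hmax _ (((convex_ball w r).segment_subset (Metric.mem_ball_self hr)
        (hεs (by simpa [Real.dist_eq] using hτ))).trans hball)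
    have hε2 : 0 < ε / 2 := by positivity
    have h1 : |ε / 2| < ε := by rw [abs_of_pos hε2]; linarith
    have a1 := hin _ h1
    have a2 := hin (-(ε / 2)) (by rwa [abs_neg])
    rw [wedge_add_right, wedge_smul_right, mul_add] at a1 a2
    have : ε / 2 * (κ * wedge d f) = 0 := by linarith
    exact mul_ne_zero hκ hdf ((mul_eq_zero.1 this).resolve_left hε2.ne')
  have hpw : p ≠ w := by
    rintro rfl
    simp [wedge] at hpos
  suffices hv : ∀ t : ℝ, 0 ≤ t → t ≤ 1 → w + t • (p - w) ∉ range P.vertex by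
    obtain ⟨e, he, hev⟩ := P.eventually_mem_visIn hwB hp hpw hv
    exact hnot e he hev
  rintro t ht0 ht1 ⟨i, hi⟩
  have hle := hcon i (by
    rw [hi]; exact mem_visIn_of_mem_segment hp (add_smul_sub_mem_segment _ _ ht0 ht1))
  rw [hi, add_sub_cancel_left, wedge_smul_right] at hle
  have ht : t = 0 := by
    by_contra hne
    have := mul_pos (ht0.lt_of_ne (Ne.symm hne)) hpos
    linarith
  refine hwB ?_
  have : w = P.vertex i := by rw [hi, ht]; simp
  rw [this]
  exact P.vertex_mem_boundary i

/-- Some vertex visible from `w` lies strictly to a prescribed side of the line through `w` in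
direction `d`, or on the backward ray of this line. -/
theorem exists_vertex_mem_visIn {w : Plane} (hw : w ∈ P.region) {d : Plane} (hd : d ≠ 0) {κ : ℝ}
    (hκ : κ ≠ 0) :
    ∃ i < P.n, P.vertex i ∈ visIn P.region w ∧
      (0 < κ * wedge d (P.vertex i - w) ∨ ∃ t : ℝ, 0 ≤ t ∧ P.vertex i - w = (-t) • d) := by
  suffices h : ∃ i, P.vertex i ∈ visIn P.region w ∧
      (0 < κ * wedge d (P.vertex i - w) ∨ ∃ t : ℝ, 0 ≤ t ∧ P.vertex i - w = (-t) • d) by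
    obtain ⟨i, hi⟩ := h
    exact ⟨i % P.n, Nat.mod_lt _ P.n_pos, by rwa [P.vertex_mod]⟩
  by_cases hwB : w ∈ P.boundary
  swap
  · obtain ⟨i, hi, hpos⟩ := P.exists_vertex_mem_visIn_of_notMem_boundary hw hwB hd hκ
    exact ⟨i, hi, Or.inl hpos⟩
  obtain ⟨i, hi, hz⟩ := P.mem_boundary_iff.1 hwB
  have hvis : ∀ x ∈ segment ℝ (P.vertex i) (P.vertex (i + 1)), x ∈ visIn P.region w :=
    fun x hx => ((convex_segment _ _).segment_subset hz hx).trans (P.segment_subset_region hi)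
  have h0 := hvis _ (left_mem_segment ℝ _ _)
  have h1 := hvis _ (right_mem_segment ℝ _ _)
  by_contra! hcon
  obtain ⟨g0, n0⟩ := hcon i h0
  obtain ⟨g1, n1⟩ := hcon (i + 1) h1
  rw [segment_eq_image'] at hz
  obtain ⟨s, hs, rfl⟩ := hz
  set a := P.vertex i
  set b := P.vertex (i + 1)
  have ea : a - (a + s • (b - a)) = (-s) • (b - a) := by module
  have eb : b - (a + s • (b - a)) = (1 - s) • (b - a) := by module
  rw [ea] at g0 n0
  rw [eb] at g1 n1
  rw [wedge_smul_right] at g0 g1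
  have hs0 : s ≠ 0 := by
    rintro rfl
    exact n0 0 le_rfl (by simp)
  have hs1 : s ≠ 1 := by
    rintro rfl
    exact n1 0 le_rfl (by simp)
  have hs0' : 0 < s := hs.1.lt_of_ne hs0.symm
  have hs1' : 0 < 1 - s := by linarith [hs.2.lt_of_ne hs1]
  have k0 : 0 ≤ κ * wedge d (b - a) := by
    by_contra! h
    have := mul_neg_of_pos_of_neg hs0' h
    linarith
  have k1 : κ * wedge d (b - a) ≤ 0 := by
    by_contra! h
    have := mul_pos hs1' h
    linarith
  obtain ⟨c, hc⟩ := exists_smul_of_wedge_eq_zero hd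
    ((mul_eq_zero.1 (le_antisymm k1 k0)).resolve_left hκ)
  rw [hc, smul_smul] at n0 n1
  rcases le_total 0 c with h | h
  · exact n0 (s * c) (mul_nonneg hs.1 h) (by rw [neg_mul])
  · exact n1 (-((1 - s) * c)) (by nlinarith) (by rw [neg_neg])

end SimplePolygon

end

namespace SimplePolygon

variable (P : SimplePolygon)

theorem Vis_eq_visIn (p : Plane) : P.Vis p = visIn P.region p := by
  ext q
  exact ⟨fun h => h.2, fun h => ⟨mem_of_mem_visIn h, h⟩⟩

theorem isClosed_Vis (p : Plane) : IsClosed (P.Vis p) :=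
  P.Vis_eq_visIn p ▸ isClosed_visIn P.isClosed_region p

theorem self_mem_Vis {p : Plane} (hp : p ∈ P.region) : p ∈ P.Vis p := by
  simpa [Vis] using hp

theorem segment_subset_Vis {p q : Plane} (hq : q ∈ P.Vis p) : segment ℝ p q ⊆ P.Vis p := by
  rw [Vis_eq_visIn] at hq ⊢
  exact fun x hx => mem_visIn_of_mem_segment hq hx

theorem isPreconnected_Vis {p : Plane} (hp : p ∈ P.region) : IsPreconnected (P.Vis p) :=
  ((starConvex_iff_segment_subset.2 fun _ hq => P.segment_subset_Vis hq).isPathConnected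
    (P.self_mem_Vis hp)).isConnected.isPreconnected

variable {P} {W : Set Plane}

namespace IsWitnessSet

theorem disjoint_Vis (hW : P.IsWitnessSet W) {x y : Plane} (hx : x ∈ W) (hy : y ∈ W)
    (hxy : x ≠ y) : Disjoint (P.Vis x) (P.Vis y) :=
  disjoint_iff_inter_eq_empty.2 (hW.2.2 x hx y hy hxy)

/-- A segment of the polygon from `Vis w` to the visibility region of another witness contains an
exit from `Vis w` into the visibility region of a neighbor of `w`. -/
theorem exists_isExit (hW : P.IsWitnessSet W) {w u' p q' : Plane} (hw : w ∈ W) (hu' : u' ∈ W)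
    (hne : u' ≠ w) (hp : p ∈ P.Vis w) (hq' : q' ∈ P.Vis u') (hpq : segment ℝ p q' ⊆ P.region) :
    ∃ c q u : Plane, ∃ s : ℝ, 0 ≤ s ∧ p = c + s • (c - q) ∧ IsExit P.region w c q ∧
      q ∈ P.Vis u ∧ P.GConAdj W w u := by
  have hf : Continuous fun t : ℝ => p + t • (q' - p) := by fun_prop
  obtain ⟨a, ⟨⟨ha0, ha1⟩, haw⟩, hamax⟩ :=
    (isCompact_Icc.inter_right ((P.isClosed_Vis w).preimage hf)).exists_isGreatest
      (⟨0, ⟨le_rfl, zero_le_one⟩, by simpa using hp⟩ :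
        (Icc (0 : ℝ) 1 ∩ (fun t : ℝ => p + t • (q' - p)) ⁻¹' P.Vis w).Nonempty)
  have hUc : IsClosed (⋃ u ∈ W \ {w}, P.Vis u) :=
    (hW.1.sdiff).isClosed_biUnion fun u _ => P.isClosed_Vis u
  obtain ⟨b, ⟨⟨hab, hb1⟩, hbU⟩, hbmin⟩ :=
    (isCompact_Icc.inter_right (hUc.preimage hf)).exists_isLeast
      (⟨1, ⟨ha1, le_rfl⟩, mem_biUnion (show u' ∈ W \ {w} from ⟨hu', hne⟩) (by simpa using hq')⟩ :
        (Icc a 1 ∩ (fun t : ℝ => p + t • (q' - p)) ⁻¹' ⋃ u ∈ W \ {w}, P.Vis u).Nonempty)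
  obtain ⟨u, ⟨huW, huw⟩, hbu⟩ := mem_iUnion₂.1 hbU
  rw [mem_singleton_iff] at huw
  simp only [mem_preimage] at haw hbu
  have hab' : a < b := hab.lt_of_ne fun h =>
    (hW.disjoint_Vis hw huW (Ne.symm huw)).notMem_of_mem_left haw (h ▸ hbu)
  have hd : 0 < b - a := sub_pos.2 hab'
  have hqc : p + b • (q' - p) - (p + a • (q' - p)) = (b - a) • (q' - p) := by module
  have hpt : ∀ t : ℝ, p + a • (q' - p) + t • (p + b • (q' - p) - (p + a • (q' - p))) =
      p + (a + t * (b - a)) • (q' - p) := fun t => by module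
  have hreg : ∀ t : ℝ, 0 ≤ t → t ≤ 1 → p + t • (q' - p) ∈ P.region := fun t h0 h1 =>
    hpq (add_smul_sub_mem_segment p q' h0 h1)
  have hle : ∀ t : ℝ, t ≤ 1 → a + t * (b - a) ≤ b := fun t ht => by
    have := mul_le_of_le_one_left hd.le ht
    linarith
  have hsub : segment ℝ (p + a • (q' - p)) (p + b • (q' - p)) ⊆
      P.Vis w ∪ P.NVis W ∪ P.Vis u := by
    rw [segment_eq_image']
    rintro _ ⟨t, ht, rfl⟩
    simp only [hpt]
    have h1 := hle t ht.2
    have h2 : a ≤ a + t * (b - a) := le_add_of_nonneg_right (mul_nonneg ht.1 hd.le)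
    generalize a + t * (b - a) = x at h1 h2
    rcases h2.eq_or_lt with rfl | h2'
    · exact Or.inl (Or.inl haw)
    rcases h1.eq_or_lt with rfl | h1'
    · exact Or.inr hbu
    refine Or.inl (Or.inr ⟨hreg x (ha0.trans h2) (h1.trans hb1), fun hx => ?_⟩)
    obtain ⟨y, hy, hxy⟩ := mem_iUnion₂.1 hx
    by_cases hyw : y = w
    · subst hyw
      exact not_lt.2 (hamax ⟨⟨ha0.trans h2, h1.trans hb1⟩, hxy⟩) h2'
    · exact not_lt.2 (hbmin ⟨⟨h2, h1.trans hb1⟩, mem_biUnion (show y ∈ W \ {w} from ⟨hy, hyw⟩) hxy⟩)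
        h1'
  refine ⟨p + a • (q' - p), p + b • (q' - p), u, a / (b - a), by positivity, ?_, ⟨?_, ?_, ?_⟩, hbu,
    hw, huW, Ne.symm huw, ?_⟩
  · rw [← neg_sub (p + b • (q' - p)), hqc, smul_neg, smul_smul, div_mul_cancel₀ _ hd.ne']
    module
  · rwa [← Vis_eq_visIn]
  · rw [segment_eq_image']
    rintro _ ⟨t, ht, rfl⟩
    simp only [hpt]
    exact hreg _ (add_nonneg ha0 (mul_nonneg ht.1 hd.le)) ((hle t ht.2).trans hb1)
  · intro t ht0 ht1 hmem
    rw [hpt, ← Vis_eq_visIn] at hmem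
    have h := mul_pos ht0 hd
    have := hamax ⟨⟨by linarith, (hle t ht1).trans hb1⟩, hmem⟩
    linarith
  · have j1 : JoinedIn (P.Vis w ∪ P.NVis W ∪ P.Vis u) w (p + a • (q' - p)) :=
      .of_segment_subset fun x hx => Or.inl (Or.inl (P.segment_subset_Vis haw hx))
    have j2 : JoinedIn (P.Vis w ∪ P.NVis W ∪ P.Vis u) (p + b • (q' - p)) u :=
      .of_segment_subset fun x hx => Or.inr (P.segment_subset_Vis hbu (segment_symm ℝ _ u ▸ hx))
    obtain ⟨γ, hγ⟩ := (j1.trans (.of_segment_subset hsub)).trans j2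
    exact ⟨_, γ, rfl, range_subset_iff.2 hγ⟩

/-- The visibility regions of two neighbors of a simplicial witness `w` lie in one continuum
invisible from `w`. -/
theorem exists_continuum (hW : P.IsWitnessSet W) {w u v : Plane} (hsimp : P.Simplicial W w)
    (hu : P.GConAdj W w u) (hv : P.GConAdj W w v) :
    ∃ K : Set Plane, IsClosed K ∧ IsPreconnected K ∧ K ⊆ P.region ∧
      Disjoint K (visIn P.region w) ∧ P.Vis u ⊆ K ∧ P.Vis v ⊆ K := by
  have hud := (hW.disjoint_Vis hu.1 hu.2.1 hu.2.2.1).symm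
  have hvd := (hW.disjoint_Vis hv.1 hv.2.1 hv.2.2.1).symm
  have huR := hW.2.1 hu.2.1
  have hvR := hW.2.1 hv.2.1
  have hsub : ∀ x, P.Vis x ⊆ P.region := fun x y hy => hy.1
  rw [← Vis_eq_visIn]
  by_cases huv : u = v
  · subst huv
    exact ⟨_, P.isClosed_Vis u, P.isPreconnected_Vis huR, hsub u, hud, Subset.rfl, Subset.rfl⟩
  obtain ⟨-, -, -, _, γ, rfl, hγ⟩ := hsimp u v hu hv huv
  have hγd : Disjoint (range γ) (P.Vis w) := by
    refine Disjoint.mono_left hγ (disjoint_union_left.2 ⟨disjoint_union_left.2 ⟨hud, ?_⟩, hvd⟩)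
    exact Set.disjoint_left.2 fun x hx hxw => hx.2 (mem_biUnion hu.1 hxw)
  have hγR : range γ ⊆ P.region :=
    hγ.trans (union_subset (union_subset (hsub u) sdiff_subset) (hsub v))
  refine ⟨P.Vis u ∪ range γ ∪ P.Vis v,
    ((P.isClosed_Vis u).union (isCompact_range γ.continuous).isClosed).union (P.isClosed_Vis v), ?_,
    union_subset (union_subset (hsub u) hγR) (hsub v),
    disjoint_union_left.2 ⟨disjoint_union_left.2 ⟨hud, hγd⟩, hvd⟩,
    fun x hx => Or.inl (Or.inl hx), fun x hx => Or.inr hx⟩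
  exact ((P.isPreconnected_Vis huR).union u (P.self_mem_Vis huR)
    (show u ∈ range γ from ⟨0, γ.source⟩)
    (isPreconnected_range γ.continuous)).union v (Or.inr ⟨1, γ.target⟩) (P.self_mem_Vis hvR)
    (P.isPreconnected_Vis hvR)

theorem exchange (hW : P.IsWitnessSet W) {w v : Plane} (hw : w ∈ W) (hv : v ∈ P.Vis w)
    (hd : ∀ u ∈ W, u ≠ w → Disjoint (P.Vis v) (P.Vis u)) :
    P.IsWitnessSet ((W \ {w}) ∪ {v}) ∧ ((W \ {w}) ∪ {v}).ncard = W.ncard := by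
  have hvW : v ∉ W \ {w} := fun h =>
    (hW.disjoint_Vis hw h.1 (Ne.symm h.2)).notMem_of_mem_left hv (P.self_mem_Vis hv.1)
  rw [union_singleton]
  refine ⟨⟨hW.1.sdiff.insert v, insert_subset hv.1 (sdiff_subset.trans hW.2.1), ?_⟩, ?_⟩
  · rintro x (rfl | hx) y (rfl | hy) hxy
    · exact absurd rfl hxy
    · exact (hd y hy.1 hy.2).inter_eq
    · exact (hd x hx.1 hx.2).symm.inter_eq
    · exact hW.2.2 x hx.1 y hy.1 hxy
  · rw [ncard_insert_of_notMem hvW hW.1.sdiff, ncard_sdiff_singleton_add_one hw hW.1]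

/-- If `v` is visible from `w` but shares a visible point with another witness, then `v` lies
behind an exit from `Vis w` into the visibility region of a neighbor of `w`. -/
theorem exists_isExit_of_not_disjoint (hW : P.IsWitnessSet W) {w u v : Plane} (hw : w ∈ W)
    (hu : u ∈ W) (hne : u ≠ w) (hv : v ∈ P.Vis w) (h : ¬ Disjoint (P.Vis v) (P.Vis u)) :
    ∃ c q u : Plane, ∃ s : ℝ, 0 ≤ s ∧ v = c + s • (c - q) ∧ IsExit P.region w c q ∧
      q ∈ P.Vis u ∧ P.GConAdj W w u := by
  obtain ⟨x, hxv, hxu⟩ := Set.not_disjoint_iff.1 h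
  exact hW.exists_isExit hw hu hne hv hxu hxv.2

end IsWitnessSet

end SimplePolygon

/-- A simplicial witness can be replaced by a vertex of the polygon. -/
theorem simplicial_replace_by_vertex (P : SimplePolygon) (W : Set Plane)
    (hW : P.IsWitnessSet W) (hreg : ∀ u ∈ W, P.VisRegular u)
    (w : Plane) (hw : w ∈ W) (hsimp : P.Simplicial W w) :
    ∃ i < P.n, P.vertex i ∈ P.Vis w ∧
      P.IsWitnessSet ((W \ {w}) ∪ {P.vertex i}) ∧
      ((W \ {w}) ∪ {P.vertex i}).ncard = W.ncard := by
  suffices h : ∃ i < P.n, P.vertex i ∈ P.Vis w ∧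
      ∀ u ∈ W, u ≠ w → Disjoint (P.Vis (P.vertex i)) (P.Vis u) by
    obtain ⟨i, hi, hiw, hd⟩ := h
    exact ⟨i, hi, hiw, hW.exchange hw hiw hd⟩
  by_cases hex : ∃ c q u : Plane, IsExit P.region w c q ∧ q ∈ P.Vis u ∧ P.GConAdj W w u
  swap
  · obtain ⟨d, hd⟩ := exists_ne (0 : Plane)
    obtain ⟨i, hi, hiw, -⟩ := P.exists_vertex_mem_visIn (hW.2.1 hw) hd (one_ne_zero (α := ℝ))
    rw [← P.Vis_eq_visIn] at hiw
    refine ⟨i, hi, hiw, fun u hu hne => ?_⟩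
    by_contra hnd
    obtain ⟨c, q, u, -, -, -, h⟩ := hW.exists_isExit_of_not_disjoint hw hu hne hiw hnd
    exact hex ⟨c, q, u, h⟩
  obtain ⟨c₁, q₁, u₁, h₁, hq₁, hu₁⟩ := hex
  have hκ : wedge (c₁ - w) (q₁ - w) ≠ 0 := by
    rw [IsExit.wedge_sub_base]
    exact h₁.wedge_ne_zero
  have hd : c₁ - w ≠ 0 := fun h => hκ (by rw [h]; simp [wedge])
  obtain ⟨i, hi, hiw, hside⟩ := P.exists_vertex_mem_visIn (hW.2.1 hw) hd hκ
  rw [← P.Vis_eq_visIn] at hiw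
  refine ⟨i, hi, hiw, fun u hu hne => ?_⟩
  by_contra hnd
  obtain ⟨c, q, u, s, hs, hv, h, hq, huw⟩ :=
    hW.exists_isExit_of_not_disjoint hw hu hne hiw hnd
  obtain ⟨K, hKc, hK, hKP, hKw, hK₁, hK₂⟩ := hW.exists_continuum hsimp hu₁ huw
  have hb := P.isBounded_region
  have hc := P.isClosed_region
  have hcc := P.isPreconnected_compl_region
  obtain ⟨t, ht0, ht⟩ :=
    IsExit.exists_eq_smul hc hb hcc hKc hK hKP hKw (hK₁ hq₁) (hK₂ hq) h₁ h
  have hpos := IsExit.wedge_mul_wedge_pos hc hb hcc hKc hK hKP hKw (hK₁ hq₁) (hK₂ hq) h₁ h ht0 ht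
  have hvw : P.vertex i - w = ((1 + s) * t) • (c₁ - w) + (-s) • (q - w) := by
    have : P.vertex i - w = (1 + s) • (c - w) + (-s) • (q - w) := by rw [hv]; module
    rw [this, ht, smul_smul]
  have hg : wedge (c₁ - w) (P.vertex i - w) = -s * wedge (c₁ - w) (q - w) := by
    rw [hvw, wedge_add_right, wedge_smul_right, wedge_smul_right, wedge_self]; ring
  have hneg := mul_nonneg hs hpos.le
  rcases hside with hgt | ⟨t', ht', hback⟩
  · rw [hg] at hgt
    linarith
  · have hs0 : s = 0 := by
      have h0 : -s * wedge (c₁ - w) (q - w) = 0 := by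
        rw [← hg, hback, wedge_smul_right, wedge_self, mul_zero]
      exact neg_eq_zero.1 ((mul_eq_zero.1 h0).resolve_right (right_ne_zero_of_mul hpos.ne'))
    have : (t + t') • (c₁ - w) = 0 := by
      rw [hs0, add_zero, one_mul, neg_zero, zero_smul, add_zero] at hvw
      rw [add_smul, ← hvw, hback, neg_smul, neg_add_cancel]
    rcases smul_eq_zero.1 this with h0 | h0
    · linarith
    · exact hd h0
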